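/- arXiv:1506.08883 — 2 statements merged into one kernel-verified Lean document; each statement's English description precedes it below -/
import Mathlib

section
/- For every qudit dimension d there exists a constant c < 1 such that the following holds. Let Ψ be a non-negative pure state on a line of L qudits of dimension d with zero correlation length, and let P(σ) = Ψ(σ)² be the induced classical probability distribution on (Fin d)^L. Then for any 1 ≤ i < j ≤ L, the classical conditional mutual information satisfies I(X_{1..i} ; X_{j..L} | X_{i+1..j−1}) ≤ c^{j−i−1} · log d, where X_R denotes the marginal on the sites in R and I(X;Y|Z) = H(XZ) + H(YZ) − H(XYZ) − H(Z) with H the Shannon entropy of the corresponding marginal distribution of P. -/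
open scoped BigOperators
open scoped Classical

/-- Combine a configuration on the sites in `R` with one on the complement. -/
def glue {L d : ℕ} (R : Finset (Fin L)) (τ : {x : Fin L // x ∈ R} → Fin d)
    (μ : {x : Fin L // x ∉ R} → Fin d) : Fin L → Fin d :=
  fun i => if h : i ∈ R then τ ⟨i, h⟩ else μ ⟨i, h⟩

/-- Reduced density matrix of `Ψ` on the set of sites `R`. -/
noncomputable def rhoR {L d : ℕ} (Ψ : (Fin L → Fin d) → ℂ) (R : Finset (Fin L)) :
    Matrix ({x : Fin L // x ∈ R} → Fin d) ({x : Fin L // x ∈ R} → Fin d) ℂ :=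
  Matrix.of fun τ τ' => ∑ μ : {x : Fin L // x ∉ R} → Fin d,
    Ψ (glue R τ μ) * (starRingEnd ℂ) (Ψ (glue R τ' μ))

def NormalizedLine {L d : ℕ} (Ψ : (Fin L → Fin d) → ℂ) : Prop :=
  ∑ σ : Fin L → Fin d, Complex.normSq (Ψ σ) = 1

def NonNegLine {L d : ℕ} (Ψ : (Fin L → Fin d) → ℂ) : Prop :=
  ∀ σ, 0 ≤ (Ψ σ).re ∧ (Ψ σ).im = 0

/-- Zero correlation length. -/
def ZeroCorr {L d : ℕ} (Ψ : (Fin L → Fin d) → ℂ) : Prop :=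
  ∀ A B : Finset (Fin L),
    (∀ a ∈ A, ∀ b ∈ B, 2 ≤ |(a : ℤ) - (b : ℤ)|) →
    ∀ τ τ' : {x : Fin L // x ∈ A ∪ B} → Fin d,
      rhoR Ψ (A ∪ B) τ τ' =
        rhoR Ψ A (fun a => τ ⟨a.1, Finset.mem_union_left B a.2⟩)
          (fun a => τ' ⟨a.1, Finset.mem_union_left B a.2⟩) *
        rhoR Ψ B (fun b => τ ⟨b.1, Finset.mem_union_right A b.2⟩)
          (fun b => τ' ⟨b.1, Finset.mem_union_right A b.2⟩)

/-- Shannon entropy of the marginal on the sites in `R` of a probability distribution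
`P` on configurations of the whole line (`Real.log 0 = 0` handles `0 log 0 = 0`). -/
noncomputable def margEnt {L d : ℕ} (P : (Fin L → Fin d) → ℝ) (R : Finset (Fin L)) : ℝ :=
  -∑ τ : {x : Fin L // x ∈ R} → Fin d,
    (∑ μ : {x : Fin L // x ∉ R} → Fin d, P (glue R τ μ)) *
      Real.log (∑ μ : {x : Fin L // x ∉ R} → Fin d, P (glue R τ μ))

/-- `U` has orthonormal rows which diagonalise the positive semidefinite matrix `A`, with
eigenvalues `l`. -/
structure Diagonalizes {X : Type*} [Fintype X] (U A : Matrix X X ℝ) (l : X → ℝ) : Prop where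
  mul_transpose : U * U.transpose = 1
  transpose_mul : U.transpose * U = 1
  nonneg : ∀ a, 0 ≤ l a
  diag : U * A * U.transpose = Matrix.diagonal l

theorem Matrix.PosSemidef.exists_diagonalizes {X : Type*} [Fintype X] {A : Matrix X X ℝ}
    (hA : A.PosSemidef) : ∃ (U : Matrix X X ℝ) (l : X → ℝ), Diagonalizes U A l := by
  have h1 : (hA.1.eigenvectorUnitary : Matrix X X ℝ).transpose * hA.1.eigenvectorUnitary = 1 := by
    have := (Matrix.mem_unitaryGroup_iff'.1 hA.1.eigenvectorUnitary.2)
    simpa [Matrix.star_eq_conjTranspose] using this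
  have h2 : (hA.1.eigenvectorUnitary : Matrix X X ℝ) *
      (hA.1.eigenvectorUnitary : Matrix X X ℝ).transpose = 1 := by
    have := (Matrix.mem_unitaryGroup_iff.1 hA.1.eigenvectorUnitary.2)
    simpa [Matrix.star_eq_conjTranspose] using this
  refine ⟨(hA.1.eigenvectorUnitary : Matrix X X ℝ).transpose, hA.1.eigenvalues, ?_, ?_, ?_, ?_⟩
  · simpa using h1
  · simpa using h2
  · exact hA.eigenvalues_nonneg
  · have h3 := hA.1.spectral_theorem
    have h4 : A = (hA.1.eigenvectorUnitary : Matrix X X ℝ) *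
        Matrix.diagonal hA.1.eigenvalues *
        (hA.1.eigenvectorUnitary : Matrix X X ℝ).transpose := by
      conv_lhs => rw [h3]
      simp [Unitary.conjStarAlgAut_apply, Matrix.star_eq_conjTranspose]
    have h5 : ∀ W Dg : Matrix X X ℝ, A = W * Dg * W.transpose → W.transpose * W = 1 →
        W.transpose * A * W = Dg := by
      intro W Dg h h'
      rw [h, show W.transpose * (W * Dg * W.transpose) * W
        = (W.transpose * W) * Dg * (W.transpose * W) by simp only [Matrix.mul_assoc], h']
      simp
    exact h5 _ _ h4 h1

namespace Diagonalizes
variable {X : Type*} [Fintype X] {U A : Matrix X X ℝ} {l : X → ℝ}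

theorem eq_mul (h : Diagonalizes U A l) : A = U.transpose * Matrix.diagonal l * U := by
  rw [← h.diag, show ∀ W Dg : Matrix X X ℝ, W.transpose * (W * Dg * W.transpose) * W
      = (W.transpose * W) * Dg * (W.transpose * W) by intros; simp only [Matrix.mul_assoc],
    h.transpose_mul]
  simp

theorem trace_eq (h : Diagonalizes U A l) : A.trace = ∑ a, l a := by
  rw [h.eq_mul, Matrix.trace_mul_comm, ← Matrix.mul_assoc, h.mul_transpose]
  simp [Matrix.trace]

theorem trace_sq_eq (h : Diagonalizes U A l) : (A * A).trace = ∑ a, l a ^ 2 := by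
  rw [h.eq_mul, show ∀ W Dg : Matrix X X ℝ, W.transpose * Dg * W * (W.transpose * Dg * W)
      = W.transpose * (Dg * (W * W.transpose) * Dg * W) by intros; simp only [Matrix.mul_assoc],
    Matrix.trace_mul_comm, Matrix.mul_assoc _ _ U.transpose, h.mul_transpose]
  simp [Matrix.trace, sq]

end Diagonalizes

/-- Squared Hilbert–Schmidt norm. -/
noncomputable def hsq {X Y : Type*} [Fintype X] [Fintype Y] (C : Matrix X Y ℝ) : ℝ :=
  ∑ x, ∑ y, C x y ^ 2

theorem hsq_nonneg {X Y : Type*} [Fintype X] [Fintype Y] (C : Matrix X Y ℝ) : 0 ≤ hsq C :=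
  Finset.sum_nonneg fun _ _ => Finset.sum_nonneg fun _ _ => sq_nonneg _

theorem hsq_eq_trace {X Y : Type*} [Fintype X] [Fintype Y] (C : Matrix X Y ℝ) :
    hsq C = (C * C.transpose).trace := by
  simp [hsq, Matrix.trace, Matrix.mul_apply, sq]

theorem hsq_eq_zero {X Y : Type*} [Fintype X] [Fintype Y] {C : Matrix X Y ℝ} (h : hsq C = 0) :
    C = 0 := by
  ext x y
  have h1 := (Finset.sum_eq_zero_iff_of_nonneg
    (fun x _ => Finset.sum_nonneg fun y _ => sq_nonneg (C x y))).1 h x (Finset.mem_univ x)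
  have h2 := (Finset.sum_eq_zero_iff_of_nonneg
    (fun y _ => sq_nonneg (C x y))).1 h1 y (Finset.mem_univ y)
  simpa using h2

theorem hsq_transpose {X Y : Type*} [Fintype X] [Fintype Y] (C : Matrix X Y ℝ) :
    hsq C.transpose = hsq C := by
  unfold hsq; rw [Finset.sum_comm]; rfl

theorem hsq_conj {X Y : Type*} [Fintype X] [Fintype Y] {U : Matrix X X ℝ} {V : Matrix Y Y ℝ}
    (hU : U.transpose * U = 1) (hV : V.transpose * V = 1) (C : Matrix X Y ℝ) :
    hsq (U * C * V.transpose) = hsq C := by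
  rw [hsq_eq_trace, hsq_eq_trace]
  simp only [Matrix.transpose_mul, Matrix.transpose_transpose]
  rw [show U * C * V.transpose * (V * (C.transpose * U.transpose)) =
    U * (C * (V.transpose * V) * C.transpose * U.transpose) by simp only [Matrix.mul_assoc],
    hV, Matrix.trace_mul_comm, Matrix.mul_assoc _ U.transpose, hU]
  simp

/-- `tr (C Cᵀ C Cᵀ)`. -/
noncomputable def quart {X Y : Type*} [Fintype X] [Fintype Y] (C : Matrix X Y ℝ) : ℝ :=
  (C * C.transpose * (C * C.transpose)).trace

theorem quart_eq_hsq {X Y : Type*} [Fintype X] [Fintype Y] (C : Matrix X Y ℝ) :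
    quart C = hsq (C * C.transpose) := by
  rw [quart, hsq_eq_trace]; simp

theorem quart_transpose {X Y : Type*} [Fintype X] [Fintype Y] (C : Matrix X Y ℝ) :
    quart C.transpose = quart C := by
  unfold quart
  rw [Matrix.transpose_transpose, Matrix.mul_assoc, Matrix.trace_mul_comm]
  simp only [Matrix.mul_assoc]

theorem quart_conj {X Y : Type*} [Fintype X] [Fintype Y] {U : Matrix X X ℝ} {V : Matrix Y Y ℝ}
    (hU : U.transpose * U = 1) (hV : V.transpose * V = 1) (C : Matrix X Y ℝ) :
    quart (U * C * V.transpose) = quart C := by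
  rw [quart_eq_hsq, quart_eq_hsq, ← hsq_conj hU hU (C * C.transpose)]
  congr 1
  simp only [Matrix.transpose_mul, Matrix.transpose_transpose]
  rw [show U * C * V.transpose * (V * (C.transpose * U.transpose)) =
    U * (C * (V.transpose * V) * C.transpose * U.transpose) by simp only [Matrix.mul_assoc], hV]
  simp only [Matrix.mul_assoc, Matrix.one_mul]

/-- The sum of the squared `2 × 2` minors. -/
theorem sum_minor_sq {X Y : Type*} [Fintype X] [Fintype Y] (C : Matrix X Y ℝ) :
    ∑ x, ∑ x', ∑ y, ∑ y', (C x y * C x' y' - C x y' * C x' y) ^ 2 =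
      2 * (hsq C ^ 2 - quart C) := by
  have e1 : ∑ x, ∑ x', ∑ y, ∑ y', (C x y) ^ 2 * (C x' y') ^ 2 = hsq C ^ 2 := by
    rw [sq (hsq C)]
    unfold hsq
    rw [Finset.sum_mul_sum]
    simp_rw [Finset.sum_mul_sum]
  have e2 : ∑ x, ∑ x', ∑ y, ∑ y', (C x y') ^ 2 * (C x' y) ^ 2 = hsq C ^ 2 := by
    rw [← e1]
    refine Finset.sum_congr rfl fun x _ => Finset.sum_congr rfl fun x' _ => ?_
    rw [Finset.sum_comm]
  have e3 : ∑ x, ∑ x', ∑ y, ∑ y', (C x y * C x' y) * (C x y' * C x' y') = quart C := by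
    rw [quart_eq_hsq]
    unfold hsq
    simp_rw [Matrix.mul_apply, sq, Finset.sum_mul_sum, Matrix.transpose_apply]
  have : ∀ x y x' y', (C x y * C x' y' - C x y' * C x' y) ^ 2 =
      ((C x y) ^ 2 * (C x' y') ^ 2 + (C x y') ^ 2 * (C x' y) ^ 2)
        - 2 * ((C x y * C x' y) * (C x y' * C x' y')) := by intros; ring
  calc _ = ∑ x, ∑ x', ∑ y, ∑ y', (C x y) ^ 2 * (C x' y') ^ 2 +
        ∑ x, ∑ x', ∑ y, ∑ y', (C x y') ^ 2 * (C x' y) ^ 2 -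
        2 * ∑ x, ∑ x', ∑ y, ∑ y', (C x y * C x' y) * (C x y' * C x' y') := by
        rw [Finset.mul_sum, ← Finset.sum_add_distrib, ← Finset.sum_sub_distrib]
        refine Finset.sum_congr rfl fun x _ => ?_
        rw [Finset.mul_sum, ← Finset.sum_add_distrib, ← Finset.sum_sub_distrib]
        refine Finset.sum_congr rfl fun x' _ => ?_
        rw [Finset.mul_sum, ← Finset.sum_add_distrib, ← Finset.sum_sub_distrib]
        refine Finset.sum_congr rfl fun y _ => ?_
        rw [Finset.mul_sum, ← Finset.sum_add_distrib, ← Finset.sum_sub_distrib]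
        exact Finset.sum_congr rfl fun y' _ => this x y x' y'
    _ = _ := by rw [e1, e2, e3]; ring

theorem quart_le {X Y : Type*} [Fintype X] [Fintype Y] (C : Matrix X Y ℝ) :
    quart C ≤ hsq C ^ 2 := by
  have h : (0 : ℝ) ≤ ∑ x, ∑ x', ∑ y, ∑ y', (C x y * C x' y' - C x y' * C x' y) ^ 2 := by
    positivity
  rw [sum_minor_sq] at h; linarith

/-- Linear entropy of a Gram matrix (homogeneous of degree one). -/
noncomputable def linEnt {X : Type*} [Fintype X] (G : Matrix X X ℝ) : ℝ :=
  G.trace - (G * G).trace / G.trace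

/-- Concurrence of a Gram matrix. -/
noncomputable def conc {X : Type*} [Fintype X] (G : Matrix X X ℝ) : ℝ :=
  √(G.trace ^ 2 - (G * G).trace)

theorem linEnt_gram {X Y : Type*} [Fintype X] [Fintype Y] (C : Matrix X Y ℝ) :
    linEnt (C * C.transpose) = hsq C - quart C / hsq C := by
  rw [linEnt, hsq_eq_trace, quart]

theorem conc_gram {X Y : Type*} [Fintype X] [Fintype Y] (C : Matrix X Y ℝ) :
    conc (C * C.transpose) = √(hsq C ^ 2 - quart C) := by
  rw [conc, hsq_eq_trace, quart]

theorem linEnt_gram_transpose {X Y : Type*} [Fintype X] [Fintype Y] (C : Matrix X Y ℝ) :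
    linEnt (C.transpose * C) = linEnt (C * C.transpose) := by
  have := linEnt_gram C.transpose
  rw [Matrix.transpose_transpose, hsq_transpose, quart_transpose] at this
  rw [this, linEnt_gram]

theorem conc_gram_transpose {X Y : Type*} [Fintype X] [Fintype Y] (C : Matrix X Y ℝ) :
    conc (C.transpose * C) = conc (C * C.transpose) := by
  have := conc_gram C.transpose
  rw [Matrix.transpose_transpose, hsq_transpose, quart_transpose] at this
  rw [this, conc_gram]

theorem linEnt_smul {X : Type*} [Fintype X] (t : ℝ) (G : Matrix X X ℝ) :
    linEnt (t • G) = t * linEnt G := by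
  unfold linEnt
  rcases eq_or_ne t 0 with rfl | ht
  · simp
  · rcases eq_or_ne G.trace 0 with h | h
    · simp [h]
    · simp only [Matrix.trace_smul, Matrix.smul_mul, Matrix.mul_smul, smul_eq_mul]
      field_simp

theorem Matrix.PosSemidef.trace_mul_self_le {X : Type*} [Fintype X] {G : Matrix X X ℝ}
    (h : G.PosSemidef) : (G * G).trace ≤ G.trace ^ 2 := by
  obtain ⟨U, l, hU⟩ := h.exists_diagonalizes
  rw [hU.trace_eq, hU.trace_sq_eq]
  exact Finset.sum_sq_le_sq_sum_of_nonneg fun a _ => hU.nonneg a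

theorem linEnt_nonneg {X : Type*} [Fintype X] {G : Matrix X X ℝ} (h : G.PosSemidef) :
    0 ≤ linEnt G := by
  have h1 := h.trace_mul_self_le
  have h2 : 0 ≤ G.trace := h.trace_nonneg
  unfold linEnt
  rcases h2.eq_or_lt with h0 | h0
  · simp [← h0]
  · rw [sub_nonneg, div_le_iff₀ h0]; linarith [sq G.trace]

theorem posSemidef_gram {X Y : Type*} [Fintype X] [Fintype Y] (C : Matrix X Y ℝ) :
    (C * C.transpose).PosSemidef := by
  simpa using Matrix.posSemidef_self_mul_conjTranspose C

theorem linEnt_gram_nonneg {X Y : Type*} [Fintype X] [Fintype Y] (C : Matrix X Y ℝ) :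
    0 ≤ linEnt (C * C.transpose) := linEnt_nonneg (posSemidef_gram C)

theorem linEnt_gram_le {X Y : Type*} [Fintype X] [Fintype Y] (C : Matrix X Y ℝ) :
    linEnt (C * C.transpose) ≤ hsq C := by
  rw [linEnt_gram]
  have : 0 ≤ quart C / hsq C := div_nonneg (by rw [quart_eq_hsq]; exact hsq_nonneg _) (hsq_nonneg _)
  linarith

theorem conc_gram_sq {X Y : Type*} [Fintype X] [Fintype Y] (C : Matrix X Y ℝ) :
    conc (C * C.transpose) ^ 2 = hsq C * linEnt (C * C.transpose) := by
  rw [conc_gram, linEnt_gram, Real.sq_sqrt (sub_nonneg.2 (quart_le C))]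
  rcases eq_or_ne (hsq C) 0 with h | h
  · rw [hsq_eq_zero h]; simp [hsq, quart]
  · field_simp

theorem conc_nonneg {X : Type*} [Fintype X] (G : Matrix X X ℝ) : 0 ≤ conc G := Real.sqrt_nonneg _

/-- A family of nonnegative matrices indexed by the state of a separating site, across which the
two sides are uncorrelated. -/
structure Cut {S X Y : Type*} [Fintype S] [Fintype X] [Fintype Y] (C : S → Matrix X Y ℝ)
    (ρ : Matrix X X ℝ) (K : Matrix Y Y ℝ) : Prop where
  nonneg : ∀ s x y, 0 ≤ C s x y
  psdL : ρ.PosSemidef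
  psdR : K.PosSemidef
  cut : ∀ x x' y y', ∑ s, C s x y * C s x' y' = ρ x x' * K y y'

namespace Cut
variable {S X Y : Type*} [Fintype S] [Fintype X] [Fintype Y] {C : S → Matrix X Y ℝ}
  {ρ : Matrix X X ℝ} {K : Matrix Y Y ℝ} {U : Matrix X X ℝ} {V : Matrix Y Y ℝ} {l : X → ℝ}
  {k : Y → ℝ}

theorem swap (h : Cut C ρ K) : Cut (fun s => (C s).transpose) K ρ where
  nonneg s x y := h.nonneg s y x
  psdL := h.psdR
  psdR := h.psdL
  cut x x' y y' := by simpa [mul_comm] using h.cut y y' x x'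

theorem sum_eig (h : Cut C ρ K) (hU : Diagonalizes U ρ l) (hV : Diagonalizes V K k)
    (a a' : X) (b b' : Y) :
    ∑ s, (U * C s * V.transpose) a b * (U * C s * V.transpose) a' b' =
      Matrix.diagonal l a a' * Matrix.diagonal k b b' := by
  rw [← hU.diag, ← hV.diag]
  simp only [Matrix.mul_apply, Matrix.transpose_apply]
  have e : ∀ s, (∑ y, (∑ x, U a x * C s x y) * V b y) * (∑ y, (∑ x, U a' x * C s x y) * V b' y)
      = ∑ y, ∑ y', ∑ x, ∑ x', (U a x * V b y * U a' x' * V b' y') * (C s x y * C s x' y') := by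
    intro s
    rw [Finset.sum_mul_sum]
    refine Finset.sum_congr rfl fun y _ => Finset.sum_congr rfl fun y' _ => ?_
    rw [mul_mul_mul_comm, Finset.sum_mul_sum, Finset.sum_mul]
    refine Finset.sum_congr rfl fun x _ => ?_
    rw [Finset.sum_mul]
    refine Finset.sum_congr rfl fun x' _ => ?_
    ring
  have r1 : ∑ x', (∑ x, U a x * ρ x x') * U a' x' = ∑ x, ∑ x', U a x * U a' x' * ρ x x' := by
    rw [Finset.sum_comm]
    refine Finset.sum_congr rfl fun x' _ => ?_
    rw [Finset.sum_mul]
    exact Finset.sum_congr rfl fun x _ => by ring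
  have r2 : ∑ y', (∑ y, V b y * K y y') * V b' y' = ∑ y, ∑ y', V b y * V b' y' * K y y' := by
    rw [Finset.sum_comm]
    refine Finset.sum_congr rfl fun x' _ => ?_
    rw [Finset.sum_mul]
    exact Finset.sum_congr rfl fun x _ => by ring
  simp only [e]
  rw [r1, r2, mul_comm, Finset.sum_mul, Finset.sum_comm]
  refine Finset.sum_congr rfl fun y _ => ?_
  rw [Finset.sum_mul, Finset.sum_comm]
  refine Finset.sum_congr rfl fun y' _ => ?_
  rw [Finset.mul_sum, Finset.sum_comm]
  refine Finset.sum_congr rfl fun x _ => ?_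
  rw [Finset.mul_sum, Finset.sum_comm]
  refine Finset.sum_congr rfl fun x' _ => ?_
  rw [← Finset.mul_sum, h.cut]
  ring

theorem eig_eq_zero (h : Cut C ρ K) (hU : Diagonalizes U ρ l) (hV : Diagonalizes V K k)
    {a : X} {b : Y} (hab : l a = 0 ∨ k b = 0) (s : S) : (U * C s * V.transpose) a b = 0 := by
  have h1 := h.sum_eig hU hV a a b b
  have h2 : ∑ s, (U * C s * V.transpose) a b * (U * C s * V.transpose) a b = 0 := by
    rw [h1]; rcases hab with h | h <;> simp [h]
  have := (Finset.sum_eq_zero_iff_of_nonneg fun s _ => mul_self_nonneg _).1 h2 s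
    (Finset.mem_univ s)
  simpa using this

theorem card_mul_card_le (h : Cut C ρ K) (hU : Diagonalizes U ρ l) (hV : Diagonalizes V K k) :
    Fintype.card {a // 0 < l a} * Fintype.card {b // 0 < k b} ≤ Fintype.card S := by
  let v : {a // 0 < l a} × {b // 0 < k b} → EuclideanSpace ℝ S := fun p =>
    WithLp.toLp 2 fun s => (U * C s * V.transpose) p.1 p.2 / √(l p.1 * k p.2)
  have hv : Orthonormal ℝ v := by
    rw [orthonormal_iff_ite]
    rintro ⟨⟨a, ha⟩, ⟨b, hb⟩⟩ ⟨⟨a', ha'⟩, ⟨b', hb'⟩⟩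
    have e : inner ℝ (v (⟨a, ha⟩, ⟨b, hb⟩)) (v (⟨a', ha'⟩, ⟨b', hb'⟩)) =
        (Matrix.diagonal l a a' * Matrix.diagonal k b b') / (√(l a * k b) * √(l a' * k b')) := by
      rw [← h.sum_eig hU hV, Finset.sum_div]
      simp only [v, PiLp.inner_apply, RCLike.inner_apply, conj_trivial]
      refine Finset.sum_congr rfl fun s _ => ?_
      rw [mul_comm, div_mul_div_comm]
    rw [e]
    by_cases h1 : a = a'
    · subst h1
      by_cases h2 : b = b'
      · subst h2
        have : 0 < l a * k b := mul_pos ha hb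
        simp [Real.mul_self_sqrt this.le, this.ne']
      · simp [h2]
    · simp [h1]
  have := hv.linearIndependent.fintype_card_le_finrank
  simpa using this

theorem sum_hsq (h : Cut C ρ K) : ∑ s, hsq (C s) = ρ.trace * K.trace := by
  unfold hsq Matrix.trace
  rw [Finset.sum_mul_sum, Finset.sum_comm]
  refine Finset.sum_congr rfl fun x _ => ?_
  rw [Finset.sum_comm]
  refine Finset.sum_congr rfl fun y _ => ?_
  simp only [Matrix.diag_apply]
  rw [← h.cut]
  simp [sq]

end Cut

theorem sum_offDiag_mul {X : Type*} [Fintype X] (l : X → ℝ) :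
    ∑ a, ∑ a', (if a = a' then 0 else l a * l a') = (∑ a, l a) ^ 2 - ∑ a, l a ^ 2 := by
  have : ∀ a a', (if a = a' then 0 else l a * l a') =
      l a * l a' - if a = a' then l a ^ 2 else 0 := by
    intro a a'
    split_ifs with h
    · subst h; ring
    · ring
  simp only [this, Finset.sum_sub_distrib]
  rw [← Finset.sum_mul_sum, sq]
  simp

/-- A `2 × 2` minor is bounded by the sum of the squares of all entries. -/
theorem minor_sq_le {X Y : Type*} [Fintype X] [Fintype Y] (G : Matrix X Y ℝ) {a a' : X} {b b' : Y}
    (hb : b ≠ b') : (G a b * G a' b' - G a b' * G a' b) ^ 2 ≤ hsq G ^ 2 := by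
  have key : ∀ a, G a b ^ 2 + G a b' ^ 2 ≤ hsq G := by
    intro a
    calc G a b ^ 2 + G a b' ^ 2 = ∑ y ∈ ({b, b'} : Finset Y), G a y ^ 2 := by
          rw [Finset.sum_pair hb]
      _ ≤ ∑ y, G a y ^ 2 := Finset.sum_le_sum_of_subset_of_nonneg (Finset.subset_univ _)
          fun _ _ _ => sq_nonneg _
      _ ≤ hsq G := Finset.single_le_sum (f := fun a => ∑ y, G a y ^ 2)
          (fun _ _ => Finset.sum_nonneg fun _ _ => sq_nonneg _) (Finset.mem_univ a)
  have h1 := mul_le_mul (key a) (key a') (by positivity) (hsq_nonneg G)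
  nlinarith [sq_nonneg (G a b * G a' b + G a b' * G a' b')]

namespace Cut
variable {S X Y : Type*} [Fintype S] [Fintype X] [Fintype Y] {C : S → Matrix X Y ℝ}
  {ρ : Matrix X X ℝ} {K : Matrix Y Y ℝ} {U : Matrix X X ℝ} {V : Matrix Y Y ℝ} {l : X → ℝ}
  {k : Y → ℝ}

/-- The concurrences across a cut are submultiplicative up to the dimension of the cut site. -/
theorem sum_conc_le (h : Cut C ρ K) :
    ∑ s, conc (C s * (C s).transpose) ≤ Fintype.card S * (conc ρ * conc K) := by
  obtain ⟨U, l, hU⟩ := h.psdL.exists_diagonalizes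
  obtain ⟨V, k, hV⟩ := h.psdR.exists_diagonalizes
  let M : S → Matrix X Y ℝ := fun s => U * C s * V.transpose
  let g : S → Matrix X Y ℝ := fun s => Matrix.of fun a b => M s a b / (√(l a) * √(k b))
  have hM : ∀ s a b, M s a b = √(l a) * √(k b) * g s a b := by
    intro s a b
    by_cases h0 : l a = 0 ∨ k b = 0
    · have := h.eig_eq_zero hU hV h0 s
      simp [g, M, this]
    · push Not at h0
      have h1 : √(l a) ≠ 0 := (Real.sqrt_ne_zero (hU.nonneg a)).2 h0.1
      have h2 : √(k b) ≠ 0 := (Real.sqrt_ne_zero (hV.nonneg b)).2 h0.2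
      simp only [g, Matrix.of_apply]
      field_simp
  have hg : ∑ s, hsq (g s) ≤ Fintype.card S := by
    have e : ∀ a b, ∑ s, g s a b ^ 2 = (if 0 < l a then 1 else 0) * (if 0 < k b then 1 else 0) := by
      intro a b
      have h1 := h.sum_eig hU hV a a b b
      simp only [g, Matrix.of_apply, div_pow, mul_pow, Real.sq_sqrt (hU.nonneg _),
        Real.sq_sqrt (hV.nonneg _)]
      rw [← Finset.sum_div]
      have h2 : ∑ s, M s a b ^ 2 = l a * k b := by
        simpa [sq] using h1
      rw [h2]
      rcases (hU.nonneg a).eq_or_lt with h3 | h3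
      · simp [← h3]
      · rcases (hV.nonneg b).eq_or_lt with h4 | h4
        · simp [← h4]
        · simp [h3, h4, h3.ne', h4.ne']
    have e2 : ∑ s, hsq (g s) =
        (Fintype.card {a // 0 < l a} * Fintype.card {b // 0 < k b} : ℕ) := by
      unfold hsq
      rw [Finset.sum_comm]
      simp_rw [fun a => Finset.sum_comm (s := (Finset.univ : Finset S)) (t := Finset.univ)
        (f := fun s b => g s a b ^ 2), e, ← Finset.sum_mul_sum]
      simp [Fintype.card_subtype]
    rw [e2]
    exact_mod_cast h.card_mul_card_le hU hV
  have hs : ∀ s, conc (C s * (C s).transpose) ≤ hsq (g s) * (conc ρ * conc K) := by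
    intro s
    rw [conc_gram, ← hsq_conj hU.transpose_mul hV.transpose_mul,
      ← quart_conj hU.transpose_mul hV.transpose_mul]
    change √(hsq (M s) ^ 2 - quart (M s)) ≤ _
    have hr : conc ρ ^ 2 = ∑ a, ∑ a', (if a = a' then 0 else l a * l a') := by
      rw [conc, Real.sq_sqrt (sub_nonneg.2 h.psdL.trace_mul_self_le), sum_offDiag_mul,
        hU.trace_eq, hU.trace_sq_eq]
    have hk : conc K ^ 2 = ∑ a, ∑ a', (if a = a' then 0 else k a * k a') := by
      rw [conc, Real.sq_sqrt (sub_nonneg.2 h.psdR.trace_mul_self_le), sum_offDiag_mul,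
        hV.trace_eq, hV.trace_sq_eq]
    refine Real.sqrt_le_iff.2 ⟨mul_nonneg (hsq_nonneg _) (mul_nonneg (conc_nonneg _)
      (conc_nonneg _)), ?_⟩
    have hbound : ∑ a, ∑ a', ∑ b, ∑ b', (M s a b * M s a' b' - M s a b' * M s a' b) ^ 2 ≤
        hsq (g s) ^ 2 * (conc ρ ^ 2 * conc K ^ 2) := by
      rw [hr, hk, Finset.sum_mul, Finset.mul_sum]
      refine Finset.sum_le_sum fun a _ => ?_
      rw [Finset.sum_mul, Finset.mul_sum]
      refine Finset.sum_le_sum fun a' _ => ?_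
      rw [Finset.mul_sum, Finset.mul_sum]
      refine Finset.sum_le_sum fun b _ => ?_
      rw [Finset.mul_sum, Finset.mul_sum]
      refine Finset.sum_le_sum fun b' _ => ?_
      have e : (M s a b * M s a' b' - M s a b' * M s a' b) ^ 2 =
          (g s a b * g s a' b' - g s a b' * g s a' b) ^ 2 * (l a * l a' * (k b * k b')) := by
        rw [hM, hM, hM, hM]
        calc _ = (g s a b * g s a' b' - g s a b' * g s a' b) ^ 2 *
              (√(l a) ^ 2 * √(l a') ^ 2 * (√(k b) ^ 2 * √(k b') ^ 2)) := by ring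
          _ = _ := by
            rw [Real.sq_sqrt (hU.nonneg a), Real.sq_sqrt (hU.nonneg a'),
              Real.sq_sqrt (hV.nonneg b), Real.sq_sqrt (hV.nonneg b')]
      by_cases h1 : a = a'
      · subst h1; simp [mul_comm]
      · by_cases h2 : b = b'
        · subst h2; simp
        · rw [if_neg h1, if_neg h2, e]
          refine mul_le_mul_of_nonneg_right (minor_sq_le _ h2) ?_
          have := hU.nonneg a; have := hU.nonneg a'; have := hV.nonneg b; have := hV.nonneg b'
          positivity
    rw [sum_minor_sq] at hbound
    nlinarith [quart_le (M s)]
  calc _ ≤ ∑ s, hsq (g s) * (conc ρ * conc K) := Finset.sum_le_sum fun s _ => hs s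
    _ ≤ _ := by
      rw [← Finset.sum_mul]
      exact mul_le_mul_of_nonneg_right hg (mul_nonneg (conc_nonneg _) (conc_nonneg _))

end Cut

namespace Diagonalizes
variable {X : Type*} [Fintype X] {U A : Matrix X X ℝ} {l : X → ℝ}

theorem apply_eq (h : Diagonalizes U A l) (x y : X) : A x y = ∑ a, l a * (U a x * U a y) := by
  rw [h.eq_mul, Matrix.mul_apply]
  simp only [Matrix.mul_diagonal, Matrix.transpose_apply]
  exact Finset.sum_congr rfl fun a _ => by ring

theorem apply_le (h : Diagonalizes U A l) (x y : X) : A x y ≤ √(A x x) * √(A y y) := by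
  rw [h.apply_eq x y, h.apply_eq x x, h.apply_eq y y]
  have e : ∀ x y, ∑ a, l a * (U a x * U a y) = ∑ a, (√(l a) * U a x) * (√(l a) * U a y) := by
    intro x y
    refine Finset.sum_congr rfl fun a _ => ?_
    rw [mul_mul_mul_comm, Real.mul_self_sqrt (h.nonneg a)]
  rw [e, e, e]
  simpa [sq] using Real.sum_mul_le_sqrt_mul_sqrt Finset.univ
    (fun a => √(l a) * U a x) (fun a => √(l a) * U a y)

theorem sum_sq_eq (h : Diagonalizes U A l) (q : X → ℝ) :
    ∑ b, (∑ y, U b y * q y) ^ 2 = ∑ y, q y ^ 2 := by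
  have : (U.mulVec q) ⬝ᵥ (U.mulVec q) = q ⬝ᵥ q := by
    rw [Matrix.dotProduct_mulVec, Matrix.vecMul_mulVec, h.transpose_mul]
    simp
  simpa [dotProduct, Matrix.mulVec, sq] using this

end Diagonalizes

namespace Cut
variable {S X Y : Type*} [Fintype S] [Fintype X] [Fintype Y] {C : S → Matrix X Y ℝ}
  {ρ : Matrix X X ℝ} {K : Matrix Y Y ℝ} {U : Matrix X X ℝ} {V : Matrix Y Y ℝ} {l : X → ℝ}
  {k : Y → ℝ}

theorem mul_transpose_eq_zero (h : Cut C ρ K) (hV : Diagonalizes V K k)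
    {b : Y} (hb : k b = 0) (s : S) (x : X) : ∑ y, C s x y * V b y = 0 := by
  obtain ⟨U, l, hU⟩ := h.psdL.exists_diagonalizes
  have h1 : U.transpose * (U * C s * V.transpose) = C s * V.transpose := by
    rw [← Matrix.mul_assoc, ← Matrix.mul_assoc, hU.transpose_mul, Matrix.one_mul]
  have h2 : (U.transpose * (U * C s * V.transpose)) x b = 0 := by
    rw [Matrix.mul_apply]
    exact Finset.sum_eq_zero fun a _ => by rw [h.eig_eq_zero hU hV (Or.inr hb), mul_zero]
  rw [h1, Matrix.mul_apply] at h2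
  exact h2

theorem sqrt_sum_sq_le (h : Cut C ρ K) (hV : Diagonalizes V K k) {p : X → ℝ}
    (hp : ∀ x, 0 ≤ p x) (s : S) :
    √(∑ y, (∑ x, p x * C s x y) ^ 2) ≤
      ∑ y, (∑ x, p x * C s x y) * √(∑ b, (if 0 < k b then V b y else 0) ^ 2) := by
  set q : Y → ℝ := fun y => ∑ x, p x * C s x y with hq
  have hq0 : ∀ y, 0 ≤ q y := fun y => Finset.sum_nonneg fun x _ =>
    mul_nonneg (hp x) (h.nonneg s x y)
  refine Real.sqrt_le_iff.2 ⟨Finset.sum_nonneg fun y _ =>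
    mul_nonneg (hq0 y) (Real.sqrt_nonneg _), ?_⟩
  change ∑ y, q y ^ 2 ≤ (∑ y, q y * √(∑ b, (if 0 < k b then V b y else 0) ^ 2)) ^ 2
  have e : ∀ b, ∑ y, V b y * q y = ∑ y, (if 0 < k b then V b y else 0) * q y := by
    intro b
    split_ifs with hb
    · rfl
    · have hb0 : k b = 0 := le_antisymm (not_lt.1 hb) (hV.nonneg b)
      simp only [zero_mul, Finset.sum_const_zero, hq, Finset.mul_sum]
      rw [Finset.sum_comm]
      refine Finset.sum_eq_zero fun x _ => ?_
      rw [← mul_zero (p x), ← h.mul_transpose_eq_zero hV hb0 s x, Finset.mul_sum]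
      exact Finset.sum_congr rfl fun y _ => by ring
  rw [← hV.sum_sq_eq q]
  simp only [e]
  set W : Y → Y → ℝ := fun b y => if 0 < k b then V b y else 0
  change ∑ b, (∑ y, W b y * q y) ^ 2 ≤ (∑ y, q y * √(∑ b, W b y ^ 2)) ^ 2
  calc ∑ b, (∑ y, W b y * q y) ^ 2 = ∑ y, ∑ y', q y * q y' * ∑ b, W b y * W b y' := by
        simp only [sq, Finset.sum_mul_sum]
        rw [Finset.sum_comm]
        refine Finset.sum_congr rfl fun y _ => ?_
        rw [Finset.sum_comm]
        refine Finset.sum_congr rfl fun y' _ => ?_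
        rw [Finset.mul_sum]
        exact Finset.sum_congr rfl fun b _ => by ring
    _ ≤ ∑ y, ∑ y', q y * q y' * (√(∑ b, W b y ^ 2) * √(∑ b, W b y' ^ 2)) := by
        refine Finset.sum_le_sum fun y _ => Finset.sum_le_sum fun y' _ => ?_
        exact mul_le_mul_of_nonneg_left (Real.sum_mul_le_sqrt_mul_sqrt _ _ _)
          (mul_nonneg (hq0 y) (hq0 y'))
    _ = _ := by
        rw [sq, Finset.sum_mul_sum]
        exact Finset.sum_congr rfl fun y _ => Finset.sum_congr rfl fun y' _ => by ring

/-- Two nonnegative vectors with small overlap under `ρ` are mapped by the matrices of a cut to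
pairs of vectors with small product of norms. -/
theorem sum_norm_mul_norm_le (h : Cut C ρ K) (hK : K.trace = 1) (hV : Diagonalizes V K k)
    {p m : X → ℝ} (hp : ∀ x, 0 ≤ p x) (hm : ∀ x, 0 ≤ m x) :
    ∑ s, √(∑ y, (∑ x, p x * C s x y) ^ 2) * √(∑ y, (∑ x, m x * C s x y) ^ 2) ≤
      Fintype.card {b // 0 < k b} * ∑ x, ∑ x', p x * m x' * ρ x x' := by
  set W : Y → ℝ := fun y => √(∑ b, (if 0 < k b then V b y else 0) ^ 2) with hW
  have hW0 : ∀ y, 0 ≤ W y := fun y => Real.sqrt_nonneg _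
  have hW2 : ∑ y, W y ^ 2 = Fintype.card {b // 0 < k b} := by
    have : ∀ y, W y ^ 2 = ∑ b, (if 0 < k b then V b y else 0) ^ 2 := fun y =>
      Real.sq_sqrt (Finset.sum_nonneg fun _ _ => sq_nonneg _)
    simp only [this]
    rw [Finset.sum_comm]
    have e : ∀ b, ∑ y, (if 0 < k b then V b y else 0) ^ 2 = if 0 < k b then 1 else 0 := by
      intro b
      split_ifs
      · have := congrFun (congrFun hV.mul_transpose b) b
        simpa [Matrix.mul_apply, sq] using this
      · simp
    simp only [e]
    simp [Fintype.card_subtype]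
  set B := ∑ x, ∑ x', p x * m x' * ρ x x' with hB
  have e : ∀ y y', ∑ s, (∑ x, p x * C s x y) * (∑ x, m x * C s x y') = B * K y y' := by
    intro y y'
    simp only [Finset.sum_mul_sum]
    rw [hB, Finset.sum_mul, Finset.sum_comm]
    refine Finset.sum_congr rfl fun x _ => ?_
    rw [Finset.sum_mul, Finset.sum_comm]
    refine Finset.sum_congr rfl fun x' _ => ?_
    rw [mul_assoc, ← h.cut, Finset.mul_sum]
    exact Finset.sum_congr rfl fun s _ => by ring
  have hB0 : 0 ≤ B := by
    have : B = ∑ y, B * K y y := by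
      rw [← Finset.mul_sum, show ∑ y, K y y = 1 from hK, mul_one]
    rw [this]
    refine Finset.sum_nonneg fun y _ => ?_
    rw [← e]
    exact Finset.sum_nonneg fun s _ => mul_nonneg
      (Finset.sum_nonneg fun x _ => mul_nonneg (hp x) (h.nonneg s x y))
      (Finset.sum_nonneg fun x _ => mul_nonneg (hm x) (h.nonneg s x y))
  calc _ ≤ ∑ s, (∑ y, (∑ x, p x * C s x y) * W y) * (∑ y, (∑ x, m x * C s x y) * W y) :=
        Finset.sum_le_sum fun s _ => mul_le_mul (h.sqrt_sum_sq_le hV hp s)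
          (h.sqrt_sum_sq_le hV hm s) (Real.sqrt_nonneg _)
          (Finset.sum_nonneg fun y _ => mul_nonneg
            (Finset.sum_nonneg fun x _ => mul_nonneg (hp x) (h.nonneg s x y)) (hW0 y))
    _ = ∑ y, ∑ y', W y * W y' * (B * K y y') := by
        simp only [Finset.sum_mul_sum]
        rw [Finset.sum_comm]
        refine Finset.sum_congr rfl fun y _ => ?_
        rw [Finset.sum_comm]
        refine Finset.sum_congr rfl fun y' _ => ?_
        rw [← e, Finset.mul_sum]
        exact Finset.sum_congr rfl fun s _ => by ring
    _ ≤ ∑ y, ∑ y', W y * W y' * (B * (√(K y y) * √(K y' y'))) := by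
        refine Finset.sum_le_sum fun y _ => Finset.sum_le_sum fun y' _ => ?_
        exact mul_le_mul_of_nonneg_left (mul_le_mul_of_nonneg_left (hV.apply_le y y') hB0)
          (mul_nonneg (hW0 y) (hW0 y'))
    _ = B * (∑ y, W y * √(K y y)) ^ 2 := by
        rw [sq, Finset.sum_mul_sum, Finset.mul_sum]
        refine Finset.sum_congr rfl fun y _ => ?_
        rw [Finset.mul_sum]
        exact Finset.sum_congr rfl fun y' _ => by ring
    _ ≤ B * ((∑ y, W y ^ 2) * ∑ y, √(K y y) ^ 2) :=
        mul_le_mul_of_nonneg_left (Finset.sum_mul_sq_le_sq_mul_sq _ _ _) hB0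
    _ = _ := by
        have : ∑ y, √(K y y) ^ 2 = 1 := by
          rw [← hK]
          exact Finset.sum_congr rfl fun y _ => Real.sq_sqrt (h.psdR.diag_nonneg)
        rw [this, hW2, mul_one, mul_comm]

end Cut

namespace Diagonalizes
variable {X : Type*} [Fintype X] {U A : Matrix X X ℝ} {l : X → ℝ}

theorem quadForm_eq (h : Diagonalizes U A l) (v : X → ℝ) :
    ∑ x, ∑ y, v x * v y * A x y = ∑ a, l a * (∑ x, U a x * v x) ^ 2 := by
  have e : ∀ a, l a * (∑ x, U a x * v x) ^ 2 =
      ∑ x, ∑ y, v x * v y * (l a * (U a x * U a y)) := by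
    intro a
    rw [sq, Finset.sum_mul_sum, Finset.mul_sum]
    refine Finset.sum_congr rfl fun x _ => ?_
    rw [Finset.mul_sum]
    exact Finset.sum_congr rfl fun y _ => by ring
  simp only [e, h.apply_eq]
  rw [Finset.sum_comm (s := (Finset.univ : Finset X))]
  conv_rhs => rw [Finset.sum_comm]
  conv_lhs => rw [Finset.sum_comm]
  refine Finset.sum_congr rfl fun x _ => ?_
  rw [Finset.sum_comm]
  refine Finset.sum_congr rfl fun y _ => ?_
  rw [Finset.mul_sum]

/-- A unit vector in the span of two eigenvectors whose positive and negative parts have the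
same norm. -/
theorem exists_balanced (h : Diagonalizes U A l) {a b : X} (hab : a ≠ b) (hl : l b ≤ l a) :
    ∃ v : X → ℝ, ∑ x, v x ^ 2 = 1 ∧ ∑ x, v x * |v x| = 0 ∧
      l b ≤ ∑ x, ∑ y, v x * v y * A x y := by
  let w : ℝ → X → ℝ := fun t x => Real.cos t * U a x + Real.sin t * U b x
  have hU : ∀ a b, ∑ x, U a x * U b x = if a = b then 1 else 0 := by
    intro a b
    have := congrFun (congrFun h.mul_transpose a) b
    simpa [Matrix.mul_apply, Matrix.one_apply] using this
  have hw : ∀ t c, ∑ x, U c x * w t x =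
      Real.cos t * (if c = a then 1 else 0) + Real.sin t * (if c = b then 1 else 0) := by
    intro t c
    rw [← hU, ← hU, Finset.mul_sum, Finset.mul_sum, ← Finset.sum_add_distrib]
    exact Finset.sum_congr rfl fun x _ => by simp only [w]; ring
  have hcont : Continuous fun t => ∑ x, w t x * |w t x| := by fun_prop
  have hpi : ∑ x, w Real.pi x * |w Real.pi x| = - ∑ x, w 0 x * |w 0 x| := by
    simp [w]
  obtain ⟨t, ht⟩ : ∃ t, ∑ x, w t x * |w t x| = 0 := by
    rcases le_total 0 (∑ x, w 0 x * |w 0 x|) with h0 | h0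
    · exact mem_range_of_exists_le_of_exists_ge hcont ⟨Real.pi, by rw [hpi]; linarith⟩ ⟨0, h0⟩
    · exact mem_range_of_exists_le_of_exists_ge hcont ⟨0, h0⟩ ⟨Real.pi, by rw [hpi]; linarith⟩
  have key : ∀ f : X → ℝ, ∑ c, f c * (Real.cos t * (if c = a then 1 else 0) +
      Real.sin t * (if c = b then 1 else 0)) ^ 2 =
      f a * Real.cos t ^ 2 + f b * Real.sin t ^ 2 := by
    intro f
    have : ∀ c, f c * (Real.cos t * (if c = a then 1 else 0) +
      Real.sin t * (if c = b then 1 else 0)) ^ 2 =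
      (if c = a then f a * Real.cos t ^ 2 else 0) + (if c = b then f b * Real.sin t ^ 2 else 0) := by
      intro c
      by_cases h1 : c = a
      · subst h1; simp [hab]
      · by_cases h2 : c = b
        · subst h2; simp [h1]
        · simp [h1, h2]
    simp only [this, Finset.sum_add_distrib]
    simp
  refine ⟨w t, ?_, ht, ?_⟩
  · rw [← h.sum_sq_eq]
    simp only [hw]
    have := key fun _ => 1
    simp only [one_mul] at this
    rw [this, Real.cos_sq_add_sin_sq]
  · rw [h.quadForm_eq]
    simp only [hw]
    rw [key]
    have h1 := mul_nonneg (sub_nonneg.2 hl) (sq_nonneg (Real.cos t))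
    have h2 : l b * (Real.cos t ^ 2 + Real.sin t ^ 2) = l b := by
      rw [Real.cos_sq_add_sin_sq, mul_one]
    linarith

theorem quadForm_le (h : Diagonalizes U A l) {c : ℝ} (hc : ∀ a, l a ≤ c) (v : X → ℝ) :
    ∑ x, ∑ y, v x * v y * A x y ≤ c * ∑ x, v x ^ 2 := by
  rw [h.quadForm_eq, ← h.sum_sq_eq v, Finset.mul_sum]
  exact Finset.sum_le_sum fun a _ => mul_le_mul_of_nonneg_right (hc a) (sq_nonneg _)

/-- If two eigenvalues of a positive semidefinite symmetric matrix are nearly degenerate, there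
are two nonnegative vectors with small overlap and large expectation. -/
theorem exists_pair (h : Diagonalizes U A l) {a b : X} (hab : a ≠ b)
    (ha : ∀ c, l c ≤ l a) (hA : ∀ x y, 0 ≤ A x y) :
    ∃ p m : X → ℝ, (∀ x, 0 ≤ p x) ∧ (∀ x, 0 ≤ m x) ∧ ∑ x, p x ^ 2 = 1 / 2 ∧
      ∑ x, m x ^ 2 = 1 / 2 ∧ ∑ x, ∑ y, p x * m y * A x y ≤ (l a - l b) / 4 ∧
      l b - l a / 2 ≤ ∑ x, ∑ y, p x * p y * A x y ∧
      l b - l a / 2 ≤ ∑ x, ∑ y, m x * m y * A x y := by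
  obtain ⟨v, hv1, hv0, hvl⟩ := h.exists_balanced hab (ha b)
  let p : X → ℝ := fun x => (|v x| + v x) / 2
  let m : X → ℝ := fun x => (|v x| - v x) / 2
  have hp2 : ∑ x, p x ^ 2 = 1 / 2 := by
    have : ∀ x, p x ^ 2 = 1 / 2 * v x ^ 2 + 1 / 2 * (v x * |v x|) := by
      intro x; simp only [p]; have := sq_abs (v x); nlinarith
    simp only [this, Finset.sum_add_distrib, ← Finset.mul_sum, hv1, hv0]; norm_num
  have hm2 : ∑ x, m x ^ 2 = 1 / 2 := by
    have : ∀ x, m x ^ 2 = 1 / 2 * v x ^ 2 - 1 / 2 * (v x * |v x|) := by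
      intro x; simp only [m]; have := sq_abs (v x); nlinarith
    simp only [this, Finset.sum_sub_distrib, ← Finset.mul_sum, hv1, hv0]; norm_num
  have hsymm : ∀ x y, A x y = A y x := by
    intro x y; rw [h.apply_eq, h.apply_eq]
    exact Finset.sum_congr rfl fun a _ => by ring
  have hmp : ∑ x, ∑ y, m x * p y * A x y = ∑ x, ∑ y, p x * m y * A x y := by
    rw [Finset.sum_comm]
    refine Finset.sum_congr rfl fun x _ => Finset.sum_congr rfl fun y _ => ?_
    rw [hsymm y x]; ring
  have e1 : ∑ x, ∑ y, v x * v y * A x y = ∑ x, ∑ y, p x * p y * A x y +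
      ∑ x, ∑ y, m x * m y * A x y - 2 * ∑ x, ∑ y, p x * m y * A x y := by
    have : ∀ x y, v x * v y * A x y = p x * p y * A x y + m x * m y * A x y -
        p x * m y * A x y - m x * p y * A x y := by
      intro x y; simp only [p, m]; ring
    simp only [this, Finset.sum_add_distrib, Finset.sum_sub_distrib, hmp]; ring
  have e2 : ∑ x, ∑ y, |v x| * |v y| * A x y = ∑ x, ∑ y, p x * p y * A x y +
      ∑ x, ∑ y, m x * m y * A x y + 2 * ∑ x, ∑ y, p x * m y * A x y := by
    have : ∀ x y, |v x| * |v y| * A x y = p x * p y * A x y + m x * m y * A x y +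
        p x * m y * A x y + m x * p y * A x y := by
      intro x y; simp only [p, m]; ring
    simp only [this, Finset.sum_add_distrib, hmp]; ring
  have b1 := h.quadForm_le ha (fun x => |v x|)
  have b2 := h.quadForm_le ha p
  have b3 := h.quadForm_le ha m
  simp only [sq_abs, hv1] at b1
  rw [hp2] at b2
  rw [hm2] at b3
  have hp : ∀ x, 0 ≤ p x := fun x => by simp only [p]; linarith [neg_abs_le (v x)]
  have hm : ∀ x, 0 ≤ m x := fun x => by simp only [m]; linarith [le_abs_self (v x)]
  have b4 : 0 ≤ ∑ x, ∑ y, p x * m y * A x y := Finset.sum_nonneg fun x _ =>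
    Finset.sum_nonneg fun y _ => mul_nonneg (mul_nonneg (hp x) (hm y)) (hA x y)
  exact ⟨p, m, hp, hm, hp2, hm2, by linarith, by linarith, by linarith⟩

end Diagonalizes

theorem abs_sum_mul_le {X : Type*} [Fintype X] (f g : X → ℝ) :
    |∑ x, f x * g x| ≤ √(∑ x, f x ^ 2) * √(∑ x, g x ^ 2) := by
  rw [abs_le]
  have h1 := Real.sum_mul_le_sqrt_mul_sqrt Finset.univ f g
  have h2 := Real.sum_mul_le_sqrt_mul_sqrt Finset.univ (fun x => - f x) g
  simp only [neg_mul, Finset.sum_neg_distrib, neg_sq] at h2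
  exact ⟨by linarith, h1⟩

theorem row_sq_le {X Y : Type*} [Fintype X] [Fintype Y] (M : Matrix X Y ℝ) (a : X) :
    ∑ y, M a y ^ 2 ≤ hsq M :=
  Finset.single_le_sum (f := fun a => ∑ y, M a y ^ 2)
    (fun _ _ => Finset.sum_nonneg fun _ _ => sq_nonneg _) (Finset.mem_univ a)

theorem col_sq_le {X Y : Type*} [Fintype X] [Fintype Y] (M : Matrix X Y ℝ) (b : Y) :
    ∑ x, M x b ^ 2 ≤ hsq M := by
  rw [← hsq_transpose]; exact row_sq_le M.transpose b

theorem entry_sq_le {X Y : Type*} [Fintype X] [Fintype Y] (M : Matrix X Y ℝ) (a : X) (b : Y) :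
    M a b ^ 2 ≤ hsq M :=
  (Finset.single_le_sum (f := fun y => M a y ^ 2) (fun _ _ => sq_nonneg _)
    (Finset.mem_univ b)).trans (row_sq_le M a)

/-- An entry linking two different values of the spectra forces a deviation of the Gram matrices
from multiples of the given diagonal matrices. -/
theorem abs_sub_mul_sq_le {X Y : Type*} [Fintype X] [Fintype Y] (M : Matrix X Y ℝ) (l : X → ℝ)
    (k : Y → ℝ) (a : X) (b : Y) :
    |l a - k b| * M a b ^ 2 ≤
      √(hsq (M * M.transpose - hsq M • Matrix.diagonal l)) +
      √(hsq (M.transpose * M - hsq M • Matrix.diagonal k)) := by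
  set p := hsq M with hp
  have hp0 : 0 ≤ p := hsq_nonneg M
  set E := M * M.transpose - p • Matrix.diagonal l with hE
  set E' := M.transpose * M - p • Matrix.diagonal k with hE'
  have e1 : ∑ a', E a a' * M a' b = (M * M.transpose * M) a b - p * l a * M a b := by
    have : (E * M) a b = (M * M.transpose * M) a b - p * l a * M a b := by
      rw [hE, Matrix.sub_mul, Matrix.smul_mul, Matrix.sub_apply, Matrix.smul_apply,
        Matrix.diagonal_mul, smul_eq_mul, mul_assoc p]
    rw [← this, Matrix.mul_apply]
  have e2 : ∑ b', M a b' * E' b' b = (M * M.transpose * M) a b - p * k b * M a b := by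
    have : (M * E') a b = (M * M.transpose * M) a b - p * k b * M a b := by
      rw [hE', Matrix.mul_sub, Matrix.mul_smul, Matrix.sub_apply, Matrix.smul_apply,
        Matrix.mul_diagonal, smul_eq_mul, Matrix.mul_assoc]
      ring
    rw [← this, Matrix.mul_apply]
  have b1 : |∑ a', E a a' * M a' b| ≤ √(hsq E) * √p :=
    (abs_sum_mul_le _ _).trans (mul_le_mul (Real.sqrt_le_sqrt (row_sq_le E a))
      (Real.sqrt_le_sqrt (col_sq_le M b)) (Real.sqrt_nonneg _) (Real.sqrt_nonneg _))
  have b2 : |∑ b', M a b' * E' b' b| ≤ √p * √(hsq E') :=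
    (abs_sum_mul_le _ _).trans (mul_le_mul (Real.sqrt_le_sqrt (row_sq_le M a))
      (Real.sqrt_le_sqrt (col_sq_le E' b)) (Real.sqrt_nonneg _) (Real.sqrt_nonneg _))
  have b3 : |M a b| ≤ √p := Real.abs_le_sqrt (entry_sq_le M a b)
  rcases hp0.eq_or_lt with h0 | h0
  · have : M a b = 0 := by simpa [← h0] using b3
    rw [this]
    have := Real.sqrt_nonneg (hsq E); have := Real.sqrt_nonneg (hsq E')
    simp; positivity
  have b4 : p * (|l a - k b| * |M a b|) ≤ √p * (√(hsq E) + √(hsq E')) := by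
    have : p * (|l a - k b| * |M a b|) = |∑ b', M a b' * E' b' b - ∑ a', E a a' * M a' b| := by
      rw [e1, e2, ← abs_mul, ← abs_of_pos h0, ← abs_mul, abs_of_pos h0]
      congr 1; ring
    rw [this]
    refine (abs_sub _ _).trans ?_
    linarith
  have b5 : p * (|l a - k b| * M a b ^ 2) ≤ p * (√(hsq E) + √(hsq E')) := by
    calc p * (|l a - k b| * M a b ^ 2) = p * (|l a - k b| * |M a b|) * |M a b| := by
          rw [← sq_abs (M a b)]; ring
      _ ≤ √p * (√(hsq E) + √(hsq E')) * √p := by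
          refine mul_le_mul b4 b3 (abs_nonneg _) ?_
          positivity
      _ = (√p * √p) * (√(hsq E) + √(hsq E')) := by ring
      _ = _ := by rw [Real.mul_self_sqrt hp0]
  exact le_of_mul_le_mul_left b5 h0

namespace Cut
variable {S X Y : Type*} [Fintype S] [Fintype X] [Fintype Y] {C : S → Matrix X Y ℝ}
  {ρ : Matrix X X ℝ} {K : Matrix Y Y ℝ} {U : Matrix X X ℝ} {V : Matrix Y Y ℝ} {l : X → ℝ}
  {k : Y → ℝ}

theorem sum_gram (h : Cut C ρ K) : ∑ s, C s * (C s).transpose = K.trace • ρ := by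
  ext x x'
  rw [Matrix.sum_apply, Matrix.smul_apply, smul_eq_mul, mul_comm, Matrix.trace, Finset.mul_sum]
  simp only [Matrix.mul_apply, Matrix.transpose_apply]
  rw [Finset.sum_comm]
  exact Finset.sum_congr rfl fun y _ => h.cut x x' y y

theorem sum_deviation (h : Cut C ρ K) (hρ : ρ.trace = 1) (hK : K.trace = 1) :
    ∑ s, hsq (C s * (C s).transpose - hsq (C s) • ρ) / hsq (C s) =
      linEnt ρ - ∑ s, linEnt (C s * (C s).transpose) := by
  have hsymm : ∀ x y, ρ y x = ρ x y := fun x y => by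
    simpa using h.psdL.1.apply x y
  have hh : hsq ρ = (ρ * ρ).trace := by
    simp [hsq, Matrix.trace, Matrix.mul_apply, sq, hsymm]
  have e1 : ∀ s, hsq (C s * (C s).transpose - hsq (C s) • ρ) / hsq (C s) =
      quart (C s) / hsq (C s) - 2 * (∑ x, ∑ y, (C s * (C s).transpose) x y * ρ x y)
        + hsq (C s) * hsq ρ := by
    intro s
    rcases eq_or_ne (hsq (C s)) 0 with h0 | h0
    · rw [h0, hsq_eq_zero h0]; simp
    · have : hsq (C s * (C s).transpose - hsq (C s) • ρ) = quart (C s) -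
          2 * hsq (C s) * (∑ x, ∑ y, (C s * (C s).transpose) x y * ρ x y) +
          hsq (C s) ^ 2 * hsq ρ := by
        rw [quart_eq_hsq]
        generalize hsq (C s) = t
        simp only [hsq, Finset.mul_sum, ← Finset.sum_sub_distrib, ← Finset.sum_add_distrib]
        refine Finset.sum_congr rfl fun x _ => Finset.sum_congr rfl fun y _ => ?_
        simp only [Matrix.sub_apply, Matrix.smul_apply, smul_eq_mul]
        ring
      rw [this]
      field_simp
  have e2 : ∑ s, ∑ x, ∑ y, (C s * (C s).transpose) x y * ρ x y = hsq ρ := by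
    have h1 := h.sum_gram
    rw [hK, one_smul] at h1
    rw [Finset.sum_comm]
    refine Finset.sum_congr rfl fun x _ => ?_
    rw [Finset.sum_comm]
    refine Finset.sum_congr rfl fun y _ => ?_
    rw [← Finset.sum_mul, ← Matrix.sum_apply, h1, sq]
  have e3 := h.sum_hsq
  rw [hρ, hK, one_mul] at e3
  simp only [e1, Finset.sum_add_distrib, Finset.sum_sub_distrib, ← Finset.mul_sum,
    ← Finset.sum_mul, e2, e3, linEnt_gram]
  rw [linEnt, hρ, hh]; ring

/-- Total Hilbert–Schmidt deviation of the conditional left density matrices. -/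
theorem sum_sqrt_deviation_le (h : Cut C ρ K) (hρ : ρ.trace = 1) (hK : K.trace = 1) :
    (∑ s, √(hsq (C s * (C s).transpose - hsq (C s) • ρ))) ^ 2 ≤
      linEnt ρ - ∑ s, linEnt (C s * (C s).transpose) := by
  have e3 := h.sum_hsq
  rw [hρ, hK, one_mul] at e3
  rw [← h.sum_deviation hρ hK, ← one_mul (∑ s, _ / _), ← e3]
  refine Finset.sum_sq_le_sum_mul_sum_of_sq_le_mul _ (fun s _ => hsq_nonneg _)
    (fun s _ => div_nonneg (hsq_nonneg _) (hsq_nonneg _)) fun s _ => le_of_eq ?_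
  rw [Real.sq_sqrt (hsq_nonneg _)]
  rcases eq_or_ne (hsq (C s)) 0 with h0 | h0
  · rw [h0, hsq_eq_zero h0]; simp [hsq]
  · field_simp

/-- Eigenvalues on the two sides of a cut nearly agree if the deviations are small. -/
theorem abs_sub_mul_le (h : Cut C ρ K) (hU : Diagonalizes U ρ l) (hV : Diagonalizes V K k)
    (a : X) (b : Y) : |l a - k b| * (l a * k b) ≤
      ∑ s, √(hsq (C s * (C s).transpose - hsq (C s) • ρ)) +
      ∑ s, √(hsq ((C s).transpose * C s - hsq (C s) • K)) := by
  have h1 := h.sum_eig hU hV a a b b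
  simp only [Matrix.diagonal_apply_eq] at h1
  rw [← h1, Finset.mul_sum, ← Finset.sum_add_distrib]
  refine Finset.sum_le_sum fun s _ => ?_
  have h2 := abs_sub_mul_sq_le (U * C s * V.transpose) l k a b
  rw [sq, hsq_conj hU.transpose_mul hV.transpose_mul] at h2
  refine h2.trans (le_of_eq ?_)
  congr 2
  · rw [← hsq_conj hU.transpose_mul hU.transpose_mul (C s * _ - _)]
    congr 1
    rw [Matrix.mul_sub, Matrix.sub_mul, Matrix.mul_smul, Matrix.smul_mul, hU.diag]
    congr 1
    simp only [Matrix.transpose_mul, Matrix.transpose_transpose]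
    rw [show U * C s * V.transpose * (V * ((C s).transpose * U.transpose)) =
      U * (C s * (V.transpose * V) * (C s).transpose) * U.transpose by simp only [Matrix.mul_assoc],
      hV.transpose_mul, Matrix.mul_one]
  · rw [← hsq_conj hV.transpose_mul hV.transpose_mul ((C s).transpose * _ - _)]
    congr 1
    rw [Matrix.mul_sub, Matrix.sub_mul, Matrix.mul_smul, Matrix.smul_mul, hV.diag]
    congr 1
    simp only [Matrix.transpose_mul, Matrix.transpose_transpose]
    rw [show V * ((C s).transpose * U.transpose) * (U * C s * V.transpose) =
      V * ((C s).transpose * (U.transpose * U) * C s) * V.transpose by simp only [Matrix.mul_assoc],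
      hU.transpose_mul, Matrix.mul_one]

end Cut

theorem abs_quadForm_le {X : Type*} [Fintype X] (A : Matrix X X ℝ) (p : X → ℝ) :
    |∑ x, ∑ y, p x * p y * A x y| ≤ (∑ x, p x ^ 2) * √(hsq A) := by
  have h := abs_sum_mul_le (fun z : X × X => p z.1 * p z.2) (fun z => A z.1 z.2)
  simp only [Fintype.sum_prod_type] at h
  refine h.trans (le_of_eq ?_)
  have : ∑ x, ∑ y, (p x * p y) ^ 2 = (∑ x, p x ^ 2) ^ 2 := by
    rw [sq (∑ x, p x ^ 2), Finset.sum_mul_sum]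
    simp only [mul_pow]
  rw [this, Real.sqrt_sq (Finset.sum_nonneg fun _ _ => sq_nonneg _)]
  rfl

theorem sum_vecMul_sq {X Y : Type*} [Fintype X] [Fintype Y] (M : Matrix X Y ℝ) (p : X → ℝ) :
    ∑ y, (∑ x, p x * M x y) ^ 2 = ∑ x, ∑ x', p x * p x' * (M * M.transpose) x x' := by
  have e : ∀ y, (∑ x, p x * M x y) ^ 2 = ∑ x, ∑ x', p x * p x' * (M x y * M x' y) := by
    intro y
    rw [sq, Finset.sum_mul_sum]
    exact Finset.sum_congr rfl fun x _ => Finset.sum_congr rfl fun x' _ => by ring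
  simp only [e, Matrix.mul_apply, Matrix.transpose_apply, Finset.mul_sum]
  rw [Finset.sum_comm]
  refine Finset.sum_congr rfl fun x _ => ?_
  rw [Finset.sum_comm]

theorem le_sqrt_mul_sqrt {a b t : ℝ} (ha : t ≤ a) (hb : t ≤ b) :
    t ≤ √a * √b := by
  rcases le_total t 0 with h | h
  · exact h.trans (by positivity)
  · calc t = √t * √t := (Real.mul_self_sqrt h).symm
      _ ≤ _ := mul_le_mul (Real.sqrt_le_sqrt ha) (Real.sqrt_le_sqrt hb) (Real.sqrt_nonneg _)
        (Real.sqrt_nonneg _)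

theorem card_pos_of_sum_pos {X : Type*} [Fintype X] {l : X → ℝ}
    (h1 : 0 < ∑ a, l a) : 0 < Fintype.card {a // 0 < l a} := by
  rw [Fintype.card_pos_iff]
  by_contra hne
  rw [nonempty_subtype] at hne
  push Not at hne
  have := Finset.sum_nonpos fun a (_ : a ∈ Finset.univ) => hne a
  linarith

theorem one_le_card_mul {X : Type*} [Fintype X] {l : X → ℝ} (h0 : ∀ a, 0 ≤ l a)
    (h1 : ∑ a, l a = 1) {t : ℝ} (ht : ∀ a, l a ≤ t) {d : ℕ}
    (hd : Fintype.card {a // 0 < l a} ≤ d) : 1 ≤ d * t := by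
  have e : ∑ a, l a ≤ ∑ a, if 0 < l a then t else 0 := by
    refine Finset.sum_le_sum fun a _ => ?_
    split_ifs with h
    · exact ht a
    · exact not_lt.1 h
  have e2 : ∑ a, (if 0 < l a then t else 0) = Fintype.card {a // 0 < l a} * t := by
    rw [← Finset.sum_filter, Finset.sum_const, nsmul_eq_mul, Fintype.card_subtype]
  have hpos := card_pos_of_sum_pos (h1 ▸ one_pos)
  have ht0 : 0 ≤ t := by
    rw [Fintype.card_pos_iff] at hpos
    obtain ⟨a⟩ := hpos
    exact (h0 a.1).trans (ht a.1)
  rw [h1, e2] at e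
  refine e.trans (mul_le_mul_of_nonneg_right (by exact_mod_cast hd) ht0)

namespace Cut
variable {S X Y : Type*} [Fintype S] [Fintype X] [Fintype Y] {C : S → Matrix X Y ℝ}
  {ρ : Matrix X X ℝ} {K : Matrix Y Y ℝ} {U : Matrix X X ℝ} {V : Matrix Y Y ℝ} {l : X → ℝ}
  {k : Y → ℝ}

theorem left_nonneg (h : Cut C ρ K) (hK : K.trace = 1) (x x' : X) : 0 ≤ ρ x x' := by
  have : ρ x x' = ∑ y, ∑ s, C s x y * C s x' y := by
    simp only [h.cut, ← Finset.mul_sum]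
    rw [show ∑ y, K y y = 1 from hK, mul_one]
  rw [this]
  exact Finset.sum_nonneg fun y _ => Finset.sum_nonneg fun s _ =>
    mul_nonneg (h.nonneg s _ _) (h.nonneg s _ _)

/-- The conditional version of the near-degeneracy obstruction: two large eigenvalues on the left
are separated by a gap. -/
theorem gap_bound (h : Cut C ρ K) (hρ : ρ.trace = 1) (hK : K.trace = 1)
    (hU : Diagonalizes U ρ l) (hV : Diagonalizes V K k) {a b : X} (hab : a ≠ b)
    (ha : ∀ c, l c ≤ l a) (hb : 3 / 4 * l a ≤ l b) :
    l a / 4 ≤ (∑ s, √(hsq (C s * (C s).transpose - hsq (C s) • ρ))) / 2 +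
      Fintype.card {b // 0 < k b} * ((l a - l b) / 4) := by
  obtain ⟨p, m, hp, hm, hp2, hm2, hpm, hpp, hmm⟩ := hU.exists_pair hab ha (h.left_nonneg hK)
  have h1 := h.sum_norm_mul_norm_le hK hV hp hm
  have h2 : ∀ q : X → ℝ, ∑ x, q x ^ 2 = 1 / 2 →
      l b - l a / 2 ≤ ∑ x, ∑ y, q x * q y * ρ x y → ∀ s,
      hsq (C s) * (l a / 4) - √(hsq (C s * (C s).transpose - hsq (C s) • ρ)) / 2 ≤
        ∑ y, (∑ x, q x * C s x y) ^ 2 := by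
    intro q hq hq2 s
    rw [sum_vecMul_sq]
    have e := abs_quadForm_le (C s * (C s).transpose - hsq (C s) • ρ) q
    rw [hq] at e
    have e2 : ∑ x, ∑ y, q x * q y * (C s * (C s).transpose - hsq (C s) • ρ) x y =
        ∑ x, ∑ x', q x * q x' * (C s * (C s).transpose) x x' -
          hsq (C s) * ∑ x, ∑ y, q x * q y * ρ x y := by
      generalize hsq (C s) = t
      simp only [Finset.mul_sum, ← Finset.sum_sub_distrib]
      refine Finset.sum_congr rfl fun x _ => Finset.sum_congr rfl fun y _ => ?_
      simp only [Matrix.sub_apply, Matrix.smul_apply, smul_eq_mul]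
      ring
    rw [e2] at e
    have e3 := (abs_le.1 e).1
    have e4 : hsq (C s) * (l a / 4) ≤ hsq (C s) * ∑ x, ∑ y, q x * q y * ρ x y :=
      mul_le_mul_of_nonneg_left (by linarith) (hsq_nonneg _)
    linarith
  have h3 : l a / 4 - (∑ s, √(hsq (C s * (C s).transpose - hsq (C s) • ρ))) / 2 ≤
      ∑ s, √(∑ y, (∑ x, p x * C s x y) ^ 2) * √(∑ y, (∑ x, m x * C s x y) ^ 2) := by
    have e : l a / 4 - (∑ s, √(hsq (C s * (C s).transpose - hsq (C s) • ρ))) / 2 =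
        ∑ s, (hsq (C s) * (l a / 4) - √(hsq (C s * (C s).transpose - hsq (C s) • ρ)) / 2) := by
      have e3 := h.sum_hsq
      rw [hρ, hK, one_mul] at e3
      rw [Finset.sum_sub_distrib, ← Finset.sum_mul, e3, one_mul, Finset.sum_div]
    rw [e]
    exact Finset.sum_le_sum fun s _ => le_sqrt_mul_sqrt (h2 p hp2 hpp s) (h2 m hm2 hmm s)
  have h4 := mul_le_mul_of_nonneg_left hpm
    (Nat.cast_nonneg (α := ℝ) (Fintype.card {b // 0 < k b}))
  linarith

/-- If the deviations across a cut are small, all but the largest eigenvalue are small. -/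
theorem eigenvalue_lt (h : Cut C ρ K) (hρ : ρ.trace = 1) (hK : K.trace = 1)
    (hU : Diagonalizes U ρ l) (hV : Diagonalizes V K k) {θ : ℝ} (hθ : 0 < θ)
    (hT : 8 * (Fintype.card S : ℝ) ^ 3 *
      (∑ s, √(hsq (C s * (C s).transpose - hsq (C s) • ρ)) +
      ∑ s, √(hsq ((C s).transpose * C s - hsq (C s) • K))) ≤ θ)
    {a b : X} (hab : a ≠ b) (ha : ∀ c, l c ≤ l a) : l b < θ := by
  by_contra! hb
  set T1 := ∑ s, √(hsq (C s * (C s).transpose - hsq (C s) • ρ))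
  set T2 := ∑ s, √(hsq ((C s).transpose * C s - hsq (C s) • K))
  have hT1 : 0 ≤ T1 := Finset.sum_nonneg fun _ _ => Real.sqrt_nonneg _
  have hT2 : 0 ≤ T2 := Finset.sum_nonneg fun _ _ => Real.sqrt_nonneg _
  have sl : ∑ a, l a = 1 := by rw [← hU.trace_eq, hρ]
  have sk : ∑ a, k a = 1 := by rw [← hV.trace_eq, hK]
  have cl := card_pos_of_sum_pos (sl ▸ one_pos)
  have ck := card_pos_of_sum_pos (sk ▸ one_pos)
  have hcard := h.card_mul_card_le hU hV
  have cld : Fintype.card {a // 0 < l a} ≤ Fintype.card S := le_trans (by nlinarith) hcard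
  have ckd : Fintype.card {a // 0 < k a} ≤ Fintype.card S := le_trans (by nlinarith) hcard
  have hgap := h.gap_bound hρ hK hU hV hab ha
  have ckd' : (Fintype.card {b // 0 < k b} : ℝ) ≤ Fintype.card S := by exact_mod_cast ckd
  obtain ⟨⟨y0, hy0⟩⟩ := Fintype.card_pos_iff.1 ck
  obtain ⟨c, -, hc⟩ := Finset.exists_max_image Finset.univ k ⟨y0, Finset.mem_univ _⟩
  have hc' : ∀ y, k y ≤ k c := fun y => hc y (Finset.mem_univ y)
  have l1 := one_le_card_mul hU.nonneg sl ha cld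
  have k1 := one_le_card_mul hV.nonneg sk hc' ckd
  have f1 := h.abs_sub_mul_le hU hV a c
  have f2 := h.abs_sub_mul_le hU hV b c
  change _ ≤ T1 + T2 at f1 f2
  have hd : (1 : ℝ) ≤ Fintype.card S := by
    exact_mod_cast cl.trans_le cld
  generalize (Fintype.card S : ℝ) = d at *
  generalize (Fintype.card {b // 0 < k b} : ℝ) = e at *
  have hd0 : 0 < d := by linarith
  have hla : θ ≤ l a := hb.trans (ha b)
  have g : ∀ t, θ ≤ t → |t - k c| * (t * k c) ≤ T1 + T2 → |t - k c| * θ ≤ d * (T1 + T2) := by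
    intro t ht hh
    have u1 : θ * 1 ≤ t * (d * k c) := mul_le_mul ht k1 zero_le_one (hθ.le.trans ht)
    have u2 := mul_le_mul_of_nonneg_left u1 (abs_nonneg (t - k c))
    have u3 := mul_le_mul_of_nonneg_left hh hd0.le
    linarith
  have g1 := g _ hla f1
  have g2 := g _ hb f2
  have g3 : (l a - l b) * θ ≤ 2 * d * (T1 + T2) := by
    have : l a - l b ≤ |l a - k c| + |l b - k c| := by
      have := le_abs_self (l a - k c); have := neg_abs_le (l b - k c); linarith
    have := mul_le_mul_of_nonneg_right this hθ.le
    linarith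
  -- the gap between the two eigenvalues is at most `1 / (4 d ^ 2)`
  have g4 : 4 * d ^ 2 * (l a - l b) ≤ 1 := by
    have : (4 * d ^ 2 * (l a - l b)) * θ ≤ 1 * θ := by
      calc _ = 4 * d ^ 2 * ((l a - l b) * θ) := by ring
        _ ≤ 4 * d ^ 2 * (2 * d * (T1 + T2)) := mul_le_mul_of_nonneg_left g3 (by positivity)
        _ = 8 * d ^ 3 * (T1 + T2) := by ring
        _ ≤ 1 * θ := by linarith
    exact le_of_mul_le_mul_right this hθ
  have g5 : d * (l a - l b) ≤ 1 / 4 * l a := by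
    have : d * (d * (l a - l b)) ≤ d * (1 / 4 * l a) := by nlinarith
    exact le_of_mul_le_mul_left this hd0
  have g0 : 0 ≤ l a - l b := sub_nonneg.2 (ha b)
  have g6 : 3 / 4 * l a ≤ l b := by nlinarith
  have g7 := hgap g6
  have g8 : e * ((l a - l b) / 4) ≤ d * ((l a - l b) / 4) :=
    mul_le_mul_of_nonneg_right ckd' (by linarith)
  have g9 : 8 * d ^ 3 * T1 ≤ l a := by
    have : 8 * d ^ 3 * T1 ≤ 8 * d ^ 3 * (T1 + T2) :=
      mul_le_mul_of_nonneg_left (by linarith) (by positivity)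
    linarith
  have g10 : 8 * T1 ≤ l a := by
    have : (1 : ℝ) ≤ d ^ 3 := one_le_pow₀ hd
    nlinarith
  nlinarith

end Cut

namespace Cut
variable {S X Y : Type*} [Fintype S] [Fintype X] [Fintype Y] {C : S → Matrix X Y ℝ}
  {ρ : Matrix X X ℝ} {K : Matrix Y Y ℝ}

theorem linEnt_le_of_deviation_le (h : Cut C ρ K) (hρ : ρ.trace = 1) (hK : K.trace = 1)
    {θ : ℝ} (hθ : 0 < θ)
    (hT : 8 * (Fintype.card S : ℝ) ^ 3 *
      (∑ s, √(hsq (C s * (C s).transpose - hsq (C s) • ρ)) +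
      ∑ s, √(hsq ((C s).transpose * C s - hsq (C s) • K))) ≤ θ) :
    linEnt ρ ≤ 2 * Fintype.card S * θ := by
  obtain ⟨U, l, hU⟩ := h.psdL.exists_diagonalizes
  obtain ⟨V, k, hV⟩ := h.psdR.exists_diagonalizes
  have sl : ∑ a, l a = 1 := by rw [← hU.trace_eq, hρ]
  have sk : ∑ a, k a = 1 := by rw [← hV.trace_eq, hK]
  have cl := card_pos_of_sum_pos (sl ▸ one_pos)
  have ck := card_pos_of_sum_pos (sk ▸ one_pos)
  have hcard := h.card_mul_card_le hU hV
  have cld : Fintype.card {a // 0 < l a} ≤ Fintype.card S := le_trans (by nlinarith) hcard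
  obtain ⟨⟨x0, hx0⟩⟩ := Fintype.card_pos_iff.1 cl
  obtain ⟨a, -, ha⟩ := Finset.exists_max_image Finset.univ l ⟨x0, Finset.mem_univ _⟩
  have ha' : ∀ c, l c ≤ l a := fun y => ha y (Finset.mem_univ y)
  have hb : ∀ b, b ≠ a → l b < θ := fun b hb =>
    h.eigenvalue_lt hρ hK hU hV hθ hT hb.symm ha'
  have e1 : linEnt ρ = 1 - ∑ a, l a ^ 2 := by
    rw [linEnt, hρ, hU.trace_sq_eq]; simp
  have e2 : l a ^ 2 ≤ ∑ a, l a ^ 2 := Finset.single_le_sum (f := fun a => l a ^ 2)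
    (fun _ _ => sq_nonneg _) (Finset.mem_univ a)
  have e3 : 1 - l a ≤ Fintype.card S * θ := by
    rw [← sl, ← Finset.sum_erase_eq_sub (Finset.mem_univ a)]
    calc _ ≤ ∑ c ∈ Finset.univ.erase a, if 0 < l c then θ else 0 := by
          refine Finset.sum_le_sum fun c hc => ?_
          split_ifs with h0
          · exact (hb c (Finset.ne_of_mem_erase hc)).le
          · exact not_lt.1 h0
      _ ≤ ∑ c, if 0 < l c then θ else 0 := by
          refine Finset.sum_le_sum_of_subset_of_nonneg (Finset.subset_univ _) fun c _ _ => ?_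
          split_ifs
          · exact hθ.le
          · exact le_rfl
      _ = Fintype.card {a // 0 < l a} * θ := by
          rw [← Finset.sum_filter, Finset.sum_const, nsmul_eq_mul, Fintype.card_subtype]
      _ ≤ _ := mul_le_mul_of_nonneg_right (by exact_mod_cast cld) hθ.le
  rw [e1]
  nlinarith [sq_nonneg (1 - l a)]

/-- Quantitative doubling inequality for the linear entropy, normalised case. -/
theorem sum_linEnt_le_of_trace_one (h : Cut C ρ K) (hρ : ρ.trace = 1) (hK : K.trace = 1)
    {ε η : ℝ} (hε : 0 < ε) (hη : 0 < η)
    (hd : 1024 * (Fintype.card S : ℝ) ^ 8 * η ≤ ε ^ 2) :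
    ∑ s, linEnt (C s * (C s).transpose) ≤ ε +
      (linEnt ρ + linEnt K - 2 * ∑ s, linEnt (C s * (C s).transpose)) / η := by
  have d1 := h.sum_sqrt_deviation_le hρ hK
  have d2 := h.swap.sum_sqrt_deviation_le hK hρ
  simp only [Matrix.transpose_transpose, linEnt_gram_transpose, hsq_transpose] at d2
  set T1 := ∑ s, √(hsq (C s * (C s).transpose - hsq (C s) • ρ)) with hT1d
  set T2 := ∑ s, √(hsq ((C s).transpose * C s - hsq (C s) • K)) with hT2d
  set F := ∑ s, linEnt (C s * (C s).transpose) with hF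
  have hT1 : 0 ≤ T1 := Finset.sum_nonneg fun _ _ => Real.sqrt_nonneg _
  have hT2 : 0 ≤ T2 := Finset.sum_nonneg fun _ _ => Real.sqrt_nonneg _
  have hF1 : F ≤ 1 := by
    have := h.sum_hsq
    rw [hρ, hK, one_mul] at this
    rw [← this]
    exact Finset.sum_le_sum fun s _ => linEnt_gram_le _
  have hD : 0 ≤ (linEnt ρ + linEnt K - 2 * F) / η := by
    refine div_nonneg ?_ hη.le
    nlinarith [sq_nonneg T1, sq_nonneg T2]
  rcases le_total η (linEnt ρ + linEnt K - 2 * F) with hc | hc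
  · have : 1 ≤ (linEnt ρ + linEnt K - 2 * F) / η := by rwa [le_div_iff₀ hη, one_mul]
    linarith
  · have hcard : (0 : ℝ) < Fintype.card S := by
      have : Nonempty S := by
        by_contra hne
        rw [not_nonempty_iff] at hne
        have := h.sum_hsq
        simp [hρ, hK] at this
      exact_mod_cast Fintype.card_pos
    have hT : 8 * (Fintype.card S : ℝ) ^ 3 * (T1 + T2) ≤ ε / (2 * Fintype.card S) := by
      rw [le_div_iff₀ (by positivity)]
      have : (16 * (Fintype.card S : ℝ) ^ 4 * (T1 + T2)) ^ 2 ≤ ε ^ 2 := by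
        have h2 : (T1 + T2) ^ 2 ≤ 2 * η := by nlinarith [sq_nonneg (T1 - T2)]
        calc _ = 256 * (Fintype.card S : ℝ) ^ 8 * (T1 + T2) ^ 2 := by ring
          _ ≤ 256 * (Fintype.card S : ℝ) ^ 8 * (2 * η) :=
            mul_le_mul_of_nonneg_left h2 (by positivity)
          _ ≤ 1024 * (Fintype.card S : ℝ) ^ 8 * η := by
            have : 0 ≤ (Fintype.card S : ℝ) ^ 8 * η := by positivity
            linarith
          _ ≤ _ := hd
      have := abs_le_of_sq_le_sq' this hε.le
      linarith [this.2]
    have h1 := h.linEnt_le_of_deviation_le hρ hK (θ := ε / (2 * Fintype.card S))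
      (by positivity) hT
    rw [mul_div_cancel₀ _ (by positivity)] at h1
    nlinarith [sq_nonneg T1]

/-- Quantitative doubling inequality for the linear entropy. -/
theorem sum_linEnt_le (h : Cut C ρ K) {ε η : ℝ} (hε : 0 < ε) (hη : 0 < η)
    (hd : 1024 * (Fintype.card S : ℝ) ^ 8 * η ≤ ε ^ 2) :
    ∑ s, linEnt (C s * (C s).transpose) ≤ ε * (ρ.trace * K.trace) +
      (K.trace * linEnt ρ + ρ.trace * linEnt K
        - 2 * ∑ s, linEnt (C s * (C s).transpose)) / η := by
  have hp : 0 ≤ ρ.trace := h.psdL.trace_nonneg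
  have hq : 0 ≤ K.trace := h.psdR.trace_nonneg
  rcases (mul_nonneg hp hq).eq_or_lt with h0 | h0
  · have e : ∀ s, linEnt (C s * (C s).transpose) = 0 := by
      intro s
      have h1 := h.sum_hsq
      rw [← h0] at h1
      have h2 := (Finset.sum_eq_zero_iff_of_nonneg fun s _ => hsq_nonneg (C s)).1 h1 s
        (Finset.mem_univ s)
      rw [hsq_eq_zero h2]; simp [linEnt]
    simp only [e, ← h0]
    have := mul_nonneg hq (linEnt_nonneg h.psdL)
    have := mul_nonneg hp (linEnt_nonneg h.psdR)
    simp
    positivity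
  · have hp' : 0 < ρ.trace := by
      rcases hp.eq_or_lt with h1 | h1
      · rw [← h1] at h0; simp at h0
      · exact h1
    have hq' : 0 < K.trace := by
      rcases hq.eq_or_lt with h1 | h1
      · rw [← h1] at h0; simp at h0
      · exact h1
    set p := ρ.trace with hpd
    set q := K.trace with hqd
    have hc : Cut (fun s => (√(p * q))⁻¹ • C s) (p⁻¹ • ρ) (q⁻¹ • K) := {
      nonneg := fun s x y => mul_nonneg (by positivity) (h.nonneg s x y)
      psdL := h.psdL.smul (by positivity)
      psdR := h.psdR.smul (by positivity)
      cut := fun x x' y y' => by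
        simp only [Matrix.smul_apply, smul_eq_mul]
        have e : ∀ s, (√(p * q))⁻¹ * C s x y * ((√(p * q))⁻¹ * C s x' y') =
            (p * q)⁻¹ * (C s x y * C s x' y') := by
          intro s
          rw [mul_mul_mul_comm, ← mul_inv, Real.mul_self_sqrt h0.le]
        simp only [e, ← Finset.mul_sum, h.cut]
        rw [mul_inv]; ring }
    have key := hc.sum_linEnt_le_of_trace_one
      (by rw [Matrix.trace_smul, smul_eq_mul, ← hpd, inv_mul_cancel₀ hp'.ne'])
      (by rw [Matrix.trace_smul, smul_eq_mul, ← hqd, inv_mul_cancel₀ hq'.ne']) hε hη hd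
    have e : ∀ s, linEnt (((√(p * q))⁻¹ • C s) * ((√(p * q))⁻¹ • C s).transpose) =
        (p * q)⁻¹ * linEnt (C s * (C s).transpose) := by
      intro s
      rw [← linEnt_smul, Matrix.transpose_smul, Matrix.smul_mul, Matrix.mul_smul, smul_smul,
        ← mul_inv, Real.mul_self_sqrt h0.le]
    simp only [e, linEnt_smul, ← Finset.mul_sum] at key
    have := mul_le_mul_of_nonneg_left key h0.le
    rw [← mul_assoc, mul_inv_cancel₀ h0.ne', one_mul] at this
    refine this.trans (le_of_eq ?_)
    field_simp

end Cut

/-- Unnormalised mutual information of the weights `C x y ^ 2`. -/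
noncomputable def mutInfo {X Y : Type*} [Fintype X] [Fintype Y] (C : Matrix X Y ℝ) : ℝ :=
  ∑ x, ∑ y, C x y ^ 2 * Real.log (C x y ^ 2) + hsq C * Real.log (hsq C)
    - ∑ x, (∑ y, C x y ^ 2) * Real.log (∑ y, C x y ^ 2)
    - ∑ y, (∑ x, C x y ^ 2) * Real.log (∑ x, C x y ^ 2)

/-- The second moment of the likelihood ratio between the weights `C x y ^ 2` and the product of
their marginals. -/
noncomputable def ratioMoment {X Y : Type*} [Fintype X] [Fintype Y] (C : Matrix X Y ℝ) : ℝ :=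
  ∑ x, ∑ y, (C x y ^ 2) ^ 2 / ((∑ y', C x y' ^ 2) * ∑ x', C x' y ^ 2)

theorem row_pos {X Y : Type*} [Fintype Y] {C : Matrix X Y ℝ} {x : X} {y : Y} (h : C x y ≠ 0) :
    0 < ∑ y', C x y' ^ 2 :=
  lt_of_lt_of_le (by positivity) (Finset.single_le_sum (f := fun y => C x y ^ 2)
    (fun _ _ => sq_nonneg _) (Finset.mem_univ y))

section
variable {X Y : Type*} [Fintype X] [Fintype Y]

theorem ratioMoment_transpose (C : Matrix X Y ℝ) : ratioMoment C.transpose = ratioMoment C := by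
  unfold ratioMoment
  rw [Finset.sum_comm]
  simp only [Matrix.transpose_apply]
  exact Finset.sum_congr rfl fun x _ => Finset.sum_congr rfl fun y _ => by rw [mul_comm (∑ _, _)]

theorem ratioMoment_nonneg (C : Matrix X Y ℝ) : 0 ≤ ratioMoment C := by
  unfold ratioMoment; positivity

theorem mutInfo_eq (C : Matrix X Y ℝ) : mutInfo C = ∑ x, ∑ y, C x y ^ 2 *
    (Real.log (C x y ^ 2) + Real.log (hsq C) - Real.log (∑ y', C x y' ^ 2)
      - Real.log (∑ x', C x' y ^ 2)) := by
  simp only [mul_add, mul_sub, Finset.sum_add_distrib, Finset.sum_sub_distrib]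
  rw [Finset.sum_comm (f := fun x y => C x y ^ 2 * Real.log (∑ x', C x' y ^ 2))]
  simp only [← Finset.sum_mul]
  rfl

theorem hsq_pos {C : Matrix X Y ℝ} {x : X} {y : Y} (h : C x y ≠ 0) : 0 < hsq C :=
  lt_of_lt_of_le (by positivity) (entry_sq_le C x y)

theorem mutInfo_term_eq {C : Matrix X Y ℝ} {x : X} {y : Y} (h : C x y ≠ 0) :
    Real.log (C x y ^ 2) + Real.log (hsq C) - Real.log (∑ y', C x y' ^ 2)
      - Real.log (∑ x', C x' y ^ 2) =
    Real.log (C x y ^ 2 * hsq C / ((∑ y', C x y' ^ 2) * ∑ x', C x' y ^ 2)) := by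
  have h1 : 0 < ∑ x', C x' y ^ 2 := row_pos (C := C.transpose) (x := y) (y := x) h
  have h2 := row_pos h
  have h3 := hsq_pos h
  rw [Real.log_div (by positivity) (by positivity), Real.log_mul (by positivity) h3.ne',
    Real.log_mul h2.ne' h1.ne']
  ring

theorem mutInfo_le_log {C : Matrix X Y ℝ} {B : ℝ} (hB : 0 < B) (h : ratioMoment C ≤ B) :
    mutInfo C ≤ hsq C * Real.log B := by
  rw [mutInfo_eq]
  have key : ∀ x y, C x y ^ 2 *
      (Real.log (C x y ^ 2) + Real.log (hsq C) - Real.log (∑ y', C x y' ^ 2)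
        - Real.log (∑ x', C x' y ^ 2)) ≤
      hsq C / B * ((C x y ^ 2) ^ 2 / ((∑ y', C x y' ^ 2) * ∑ x', C x' y ^ 2)) +
        C x y ^ 2 * (Real.log B - 1) := by
    intro x y
    by_cases h0 : C x y = 0
    · simp [h0]
    · rw [mutInfo_term_eq h0]
      have h1 : 0 < ∑ x', C x' y ^ 2 := row_pos (C := C.transpose) (x := y) (y := x) h0
      have h2 := row_pos h0
      have h3 := hsq_pos h0
      have h4 : 0 < C x y ^ 2 := by positivity
      set t := C x y ^ 2 * hsq C / ((∑ y', C x y' ^ 2) * ∑ x', C x' y ^ 2) with ht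
      have ht0 : 0 < t := by positivity
      have h5 : Real.log t ≤ t / B - 1 + Real.log B := by
        have := Real.log_le_sub_one_of_pos (div_pos ht0 hB)
        rw [Real.log_div ht0.ne' hB.ne'] at this
        linarith
      calc _ ≤ C x y ^ 2 * (t / B - 1 + Real.log B) := mul_le_mul_of_nonneg_left h5 h4.le
        _ = _ := by rw [ht]; field_simp; ring
  refine (Finset.sum_le_sum fun x _ => Finset.sum_le_sum fun y _ => key x y).trans ?_
  simp only [Finset.sum_add_distrib, ← Finset.mul_sum, ← Finset.sum_mul]
  change hsq C / B * ratioMoment C + hsq C * (Real.log B - 1) ≤ _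
  have : hsq C / B * ratioMoment C ≤ hsq C := by
    rw [div_mul_eq_mul_div, div_le_iff₀ hB]
    exact mul_le_mul_of_nonneg_left h (hsq_nonneg C)
  linarith

theorem mutInfo_le_conc {C : Matrix X Y ℝ} (hC : ∀ x y, 0 ≤ C x y) :
    mutInfo C ≤ 2 * √(2 * ratioMoment C) * conc (C * C.transpose) := by
  let r : X → ℝ := fun x => ∑ y', C x y' ^ 2
  let c : Y → ℝ := fun y => ∑ x', C x' y ^ 2
  let D : X → Y → ℝ := fun x y => ∑ x', ∑ y', (C x y * C x' y' - C x y' * C x' y) ^ 2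
  have hr : ∀ x, 0 ≤ r x := fun x => Finset.sum_nonneg fun _ _ => sq_nonneg _
  have hc : ∀ x, 0 ≤ c x := fun x => Finset.sum_nonneg fun _ _ => sq_nonneg _
  have hD : ∀ x y, |C x y * √(hsq C) - √(r x * c y)| ≤ √(D x y) := by
    intro x y
    have e1 : ∑ z : X × Y, (C x y * C z.1 z.2) ^ 2 = (C x y * √(hsq C)) ^ 2 := by
      rw [Fintype.sum_prod_type, mul_pow, Real.sq_sqrt (hsq_nonneg C), hsq, Finset.mul_sum]
      simp only [Finset.mul_sum, mul_pow]
    have e2 : ∑ z : X × Y, (C x z.2 * C z.1 y) ^ 2 = √(r x * c y) ^ 2 := by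
      rw [Fintype.sum_prod_type, Real.sq_sqrt (mul_nonneg (hr x) (hc y)), mul_comm,
        Finset.sum_mul_sum]
      simp only [mul_pow]
      exact Finset.sum_congr rfl fun _ _ => Finset.sum_congr rfl fun _ _ => mul_comm _ _
    have e3 := Real.sum_mul_le_sqrt_mul_sqrt Finset.univ
      (fun z : X × Y => C x y * C z.1 z.2) (fun z => C x z.2 * C z.1 y)
    rw [e1, e2, Real.sqrt_sq (mul_nonneg (hC x y) (Real.sqrt_nonneg _)),
      Real.sqrt_sq (Real.sqrt_nonneg _)] at e3
    refine Real.abs_le_sqrt ?_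
    have e4 : D x y = ∑ z : X × Y, ((C x y * C z.1 z.2) ^ 2 + (C x z.2 * C z.1 y) ^ 2
        - 2 * ((C x y * C z.1 z.2) * (C x z.2 * C z.1 y))) := by
      simp only [D]
      rw [Fintype.sum_prod_type]
      exact Finset.sum_congr rfl fun _ _ => Finset.sum_congr rfl fun _ _ => by ring
    rw [e4, Finset.sum_sub_distrib, Finset.sum_add_distrib, e1, e2, ← Finset.mul_sum]
    nlinarith
  have key : ∀ x y, C x y ^ 2 *
      (Real.log (C x y ^ 2) + Real.log (hsq C) - Real.log (r x) - Real.log (c y)) ≤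
      2 * (C x y ^ 2 / √(r x * c y) * √(D x y)) := by
    intro x y
    by_cases h0 : C x y = 0
    · simp [h0]
    · have e := mutInfo_term_eq h0
      change _ = Real.log (C x y ^ 2 * hsq C / (r x * c y)) at e
      have h1 : 0 < c y := row_pos (C := C.transpose) (x := y) (y := x) h0
      have h2 : 0 < r x := row_pos h0
      have h3 := hsq_pos h0
      have h4 : 0 < C x y := lt_of_le_of_ne (hC x y) (Ne.symm h0)
      have hv : 0 < √(r x * c y) := Real.sqrt_pos.2 (mul_pos h2 h1)
      have hu : 0 < C x y * √(hsq C) := mul_pos h4 (Real.sqrt_pos.2 h3)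
      have e5 : C x y ^ 2 * hsq C / (r x * c y) = (C x y * √(hsq C) / √(r x * c y)) ^ 2 := by
        rw [div_pow, mul_pow, Real.sq_sqrt h3.le, Real.sq_sqrt (mul_pos h2 h1).le]
      change C x y ^ 2 * (Real.log (C x y ^ 2) + Real.log (hsq C) - Real.log (∑ y', C x y' ^ 2)
      - Real.log (∑ x', C x' y ^ 2)) ≤ _
      rw [e, e5, Real.log_pow]
      have e6 := Real.log_le_sub_one_of_pos (div_pos hu hv)
      have e7 : C x y * √(hsq C) / √(r x * c y) - 1 ≤ √(D x y) / √(r x * c y) := by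
        rw [div_sub_one hv.ne']
        exact div_le_div_of_nonneg_right ((le_abs_self _).trans (hD x y)) hv.le
      calc C x y ^ 2 * ((2 : ℕ) * Real.log (C x y * √(hsq C) / √(r x * c y))) ≤
            C x y ^ 2 * (2 * (√(D x y) / √(r x * c y))) := by
              refine mul_le_mul_of_nonneg_left ?_ (sq_nonneg _)
              push_cast
              linarith
        _ = _ := by ring
  have hcs : ∑ x, ∑ y, C x y ^ 2 / √(r x * c y) * √(D x y) ≤
      √(ratioMoment C) * √(2 * (hsq C ^ 2 - quart C)) := by
    have h1 := Real.sum_mul_le_sqrt_mul_sqrt Finset.univ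
      (fun z : X × Y => C z.1 z.2 ^ 2 / √(r z.1 * c z.2)) (fun z => √(D z.1 z.2))
    simp only [Fintype.sum_prod_type] at h1
    refine h1.trans (le_of_eq ?_)
    congr 2
    · unfold ratioMoment
      refine Finset.sum_congr rfl fun x _ => Finset.sum_congr rfl fun y _ => ?_
      rw [div_pow, Real.sq_sqrt (mul_nonneg (hr x) (hc y))]
    · rw [← sum_minor_sq]
      refine Finset.sum_congr rfl fun x _ => ?_
      rw [Finset.sum_comm]
      refine Finset.sum_congr rfl fun y _ => ?_
      rw [Real.sq_sqrt]
      exact Finset.sum_nonneg fun _ _ => Finset.sum_nonneg fun _ _ => sq_nonneg _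
  rw [mutInfo_eq, conc_gram]
  refine (Finset.sum_le_sum fun x _ => Finset.sum_le_sum fun y _ => key x y).trans ?_
  simp only [← Finset.mul_sum]
  rw [Real.sqrt_mul zero_le_two] at hcs ⊢
  linarith

theorem ratioMoment_le {C : Matrix X Y ℝ} {V K : Matrix Y Y ℝ} {k : Y → ℝ}
    (hV : Diagonalizes V K k) (h : ∀ b, ¬ 0 < k b → ∀ x, ∑ y, C x y * V b y = 0) :
    ratioMoment C ≤ Fintype.card {b // 0 < k b} := by
  have hexp : ∀ x y, C x y = ∑ b, (∑ y', C x y' * V b y') * (if 0 < k b then V b y else 0) := by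
    intro x y
    have h1 : C = C * V.transpose * V := by rw [Matrix.mul_assoc, hV.transpose_mul, Matrix.mul_one]
    have h2 := congrFun (congrFun h1 x) y
    rw [h2, Matrix.mul_apply]
    refine Finset.sum_congr rfl fun b _ => ?_
    rw [Matrix.mul_apply]
    simp only [Matrix.transpose_apply]
    by_cases hb : 0 < k b
    · simp [hb]
    · rw [h b hb x]; simp
  have hsqle : ∀ x y, C x y ^ 2 ≤
      (∑ y', C x y' ^ 2) * ∑ b, (if 0 < k b then V b y else 0) ^ 2 := by
    intro x y
    have e : ∑ y', C x y' ^ 2 = ∑ b, (∑ y', C x y' * V b y') ^ 2 := by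
      rw [← hV.sum_sq_eq]
      simp only [mul_comm]
    rw [e]
    conv_lhs => rw [hexp x y]
    exact Finset.sum_mul_sq_le_sq_mul_sq _ _ _
  have e1 : ∑ y, ∑ b, (if 0 < k b then V b y else 0) ^ 2 = Fintype.card {b // 0 < k b} := by
    rw [Finset.sum_comm]
    have e : ∀ b, ∑ y, (if 0 < k b then V b y else 0) ^ 2 = if 0 < k b then 1 else 0 := by
      intro b
      split_ifs
      · have := congrFun (congrFun hV.mul_transpose b) b
        simpa [Matrix.mul_apply, sq] using this
      · simp
    simp only [e]
    simp [Fintype.card_subtype]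
  rw [← e1]
  unfold ratioMoment
  rw [Finset.sum_comm]
  refine Finset.sum_le_sum fun y _ => ?_
  set P := ∑ b, (if 0 < k b then V b y else 0) ^ 2
  have hP : 0 ≤ P := Finset.sum_nonneg fun _ _ => sq_nonneg _
  set c := ∑ x', C x' y ^ 2 with hc
  have hc0 : 0 ≤ c := Finset.sum_nonneg fun _ _ => sq_nonneg _
  rcases hc0.eq_or_lt with h0 | h0
  · simp [← h0, hP]
  calc ∑ x, (C x y ^ 2) ^ 2 / ((∑ y', C x y' ^ 2) * c) ≤ ∑ x, C x y ^ 2 * (P / c) := by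
        refine Finset.sum_le_sum fun x _ => ?_
        by_cases hx : C x y = 0
        · simp [hx]
        · have h2 := row_pos hx
          rw [div_le_iff₀ (by positivity)]
          calc (C x y ^ 2) ^ 2 = C x y ^ 2 * C x y ^ 2 := sq _
            _ ≤ C x y ^ 2 * ((∑ y', C x y' ^ 2) * P) :=
              mul_le_mul_of_nonneg_left (hsqle x y) (sq_nonneg _)
            _ = _ := by field_simp
    _ = P := by rw [← Finset.sum_mul, ← hc]; field_simp

end

namespace Cut
variable {S X Y : Type*} [Fintype S] [Fintype X] [Fintype Y] {C : S → Matrix X Y ℝ}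
  {ρ : Matrix X X ℝ} {K : Matrix Y Y ℝ}

theorem ratioMoment_sq_le (h : Cut C ρ K) (s : S) :
    ratioMoment (C s) ^ 2 ≤ Fintype.card S := by
  obtain ⟨U, l, hU⟩ := h.psdL.exists_diagonalizes
  obtain ⟨V, k, hV⟩ := h.psdR.exists_diagonalizes
  have h1 := h.card_mul_card_le hU hV
  have h2 : ratioMoment (C s) ≤ Fintype.card {b // 0 < k b} := ratioMoment_le hV fun b hb x =>
    h.mul_transpose_eq_zero hV (le_antisymm (not_lt.1 hb) (hV.nonneg b)) s x
  have h3 : ratioMoment (C s) ≤ Fintype.card {a // 0 < l a} := by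
    rw [← ratioMoment_transpose]
    exact ratioMoment_le hU fun b hb x =>
      h.swap.mul_transpose_eq_zero hU (le_antisymm (not_lt.1 hb) (hU.nonneg b)) s x
  calc ratioMoment (C s) ^ 2 = ratioMoment (C s) * ratioMoment (C s) := sq _
    _ ≤ Fintype.card {a // 0 < l a} * Fintype.card {b // 0 < k b} :=
      mul_le_mul h3 h2 (ratioMoment_nonneg _) (Nat.cast_nonneg _)
    _ ≤ _ := by exact_mod_cast h1

theorem mutInfo_le_half_log (h : Cut C ρ K) (hS : 0 < Fintype.card S) (s : S) :
    mutInfo (C s) ≤ hsq (C s) * (1 / 2 * Real.log (Fintype.card S)) := by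
  have h0 : (0 : ℝ) < Fintype.card S := by exact_mod_cast hS
  have h1 := mutInfo_le_log (Real.sqrt_pos.2 h0) (Real.le_sqrt_of_sq_le (h.ratioMoment_sq_le s))
  rw [Real.log_sqrt h0.le] at h1
  linarith

theorem mutInfo_le_mul_conc (h : Cut C ρ K) (s : S) :
    mutInfo (C s) ≤ 2 * √(2 * √(Fintype.card S)) * conc (C s * (C s).transpose) := by
  refine (mutInfo_le_conc (h.nonneg s)).trans ?_
  refine mul_le_mul_of_nonneg_right ?_ (conc_nonneg _)
  have := Real.le_sqrt_of_sq_le (h.ratioMoment_sq_le s)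
  gcongr

/-- The mutual information between the left side of a cut and everything else. -/
theorem mutInfo_le_log_card (h : Cut C ρ K) (hρ : 0 < K.trace) (hS : 0 < Fintype.card S)
    (M : Matrix X (S × Y) ℝ) (hM : ∀ x s y, M x (s, y) = C s x y) :
    mutInfo M ≤ hsq M * Real.log (Fintype.card S) := by
  obtain ⟨U, l, hU⟩ := h.psdL.exists_diagonalizes
  obtain ⟨V, k, hV⟩ := h.psdR.exists_diagonalizes
  have h1 := h.card_mul_card_le hU hV
  rw [hV.trace_eq] at hρ
  have ck := card_pos_of_sum_pos hρ
  have h0 : (0 : ℝ) < Fintype.card S := by exact_mod_cast hS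
  refine mutInfo_le_log h0 ?_
  rw [← ratioMoment_transpose]
  refine (ratioMoment_le hU fun b hb x => ?_).trans
    (Nat.cast_le.2 (le_trans (by nlinarith) h1))
  have := h.swap.mul_transpose_eq_zero hU (le_antisymm (not_lt.1 hb) (hU.nonneg b)) x.1 x.2
  simpa [hM] using this

end Cut

theorem sum_ofFn_add {d : ℕ} (m n : ℕ) (f : List (Fin d) → ℝ) :
    ∑ z : Fin (m + n) → Fin d, f (List.ofFn z) =
      ∑ z₁ : Fin m → Fin d, ∑ z₂ : Fin n → Fin d, f (List.ofFn z₁ ++ List.ofFn z₂) := by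
  rw [← Fintype.sum_prod_type', ← (Fin.appendEquiv m n).sum_comp]
  exact Finset.sum_congr rfl fun p _ => congrArg f (List.ofFn_fin_append _ _)

theorem sum_ofFn_succ {d : ℕ} (n : ℕ) (f : List (Fin d) → ℝ) :
    ∑ z : Fin (n + 1) → Fin d, f (List.ofFn z) =
      ∑ s, ∑ z : Fin n → Fin d, f (s :: List.ofFn z) := by
  rw [← Fintype.sum_prod_type', ← (Fin.consEquiv fun _ => Fin d).sum_comp]
  exact Finset.sum_congr rfl fun p _ => by simp [Fin.consEquiv]

/-- The amplitudes `Φ (x ++ w ++ y)` around a fixed word `w`, as a matrix in the words `x` of length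
`a` and `y` of length `b`. -/
noncomputable def wordMat {d : ℕ} (Φ : List (Fin d) → ℝ) (a b : ℕ) (w : List (Fin d)) :
    Matrix (Fin a → Fin d) (Fin b → Fin d) ℝ :=
  Matrix.of fun x y => Φ (List.ofFn x ++ w ++ List.ofFn y)

/-- A normalised non-negative state on words of length `L` whose reduced density matrix factorises
after tracing out any single site. -/
structure WordState {d : ℕ} (L : ℕ) (Φ : List (Fin d) → ℝ) : Prop where
  nonneg : ∀ w, 0 ≤ Φ w
  norm : ∑ σ : Fin L → Fin d, Φ (List.ofFn σ) ^ 2 = 1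
  cut : ∀ m k, m + 1 + k = L → ∀ (u u' : Fin m → Fin d) (v v' : Fin k → Fin d),
    ∑ s, Φ (List.ofFn u ++ s :: List.ofFn v) * Φ (List.ofFn u' ++ s :: List.ofFn v') =
      (∑ w : Fin (k + 1) → Fin d,
          Φ (List.ofFn u ++ List.ofFn w) * Φ (List.ofFn u' ++ List.ofFn w)) *
        ∑ w : Fin (m + 1) → Fin d, Φ (List.ofFn w ++ List.ofFn v) * Φ (List.ofFn w ++ List.ofFn v')

namespace WordState
variable {d L : ℕ} {Φ : List (Fin d) → ℝ}

theorem cut_wordMat (h : WordState L Φ) {a n₁ n₂ b : ℕ} (hL : a + (n₁ + (n₂ + 1)) + b = L)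
    (z₁ : Fin n₁ → Fin d) (z₂ : Fin n₂ → Fin d) :
    Cut (fun s => wordMat Φ a b (List.ofFn z₁ ++ s :: List.ofFn z₂))
      (wordMat Φ a (n₂ + b + 1) (List.ofFn z₁) *
        (wordMat Φ a (n₂ + b + 1) (List.ofFn z₁)).transpose)
      ((wordMat Φ (a + n₁ + 1) b (List.ofFn z₂)).transpose *
        wordMat Φ (a + n₁ + 1) b (List.ofFn z₂)) where
  nonneg s x y := h.nonneg _
  psdL := posSemidef_gram _
  psdR := posSemidef_gram (wordMat Φ (a + n₁ + 1) b (List.ofFn z₂)).transpose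
  cut x x' y y' := by
    have := h.cut (a + n₁) (n₂ + b) (by omega) (Fin.append x z₁) (Fin.append x' z₁)
      (Fin.append z₂ y) (Fin.append z₂ y')
    simp only [List.ofFn_fin_append] at this
    simpa [wordMat, Matrix.mul_apply] using this

theorem sum_hsq (h : WordState L Φ) {a n b : ℕ} (hL : a + n + b = L) :
    ∑ z : Fin n → Fin d, hsq (wordMat Φ a b (List.ofFn z)) = 1 := by
  subst hL
  have := h.norm
  rw [sum_ofFn_add (a + n) b fun w => Φ w ^ 2,
    sum_ofFn_add a n fun w => ∑ y : Fin b → Fin d, Φ (w ++ List.ofFn y) ^ 2,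
    Finset.sum_comm] at this
  exact this

end WordState

/-- The average linear entropy across a gap of `n` sites, given the configuration of the gap. -/
noncomputable def gapLinEnt {d : ℕ} (Φ : List (Fin d) → ℝ) (a n b : ℕ) : ℝ :=
  ∑ z : Fin n → Fin d,
    linEnt (wordMat Φ a b (List.ofFn z) * (wordMat Φ a b (List.ofFn z)).transpose)

/-- The average concurrence across a gap of `n` sites, given the configuration of the gap. -/
noncomputable def gapConc {d : ℕ} (Φ : List (Fin d) → ℝ) (a n b : ℕ) : ℝ :=
  ∑ z : Fin n → Fin d, conc (wordMat Φ a b (List.ofFn z) * (wordMat Φ a b (List.ofFn z)).transpose)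

/-- The conditional mutual information across a gap of `n` sites. -/
noncomputable def gapMutInfo {d : ℕ} (Φ : List (Fin d) → ℝ) (a n b : ℕ) : ℝ :=
  ∑ z : Fin n → Fin d, mutInfo (wordMat Φ a b (List.ofFn z))

namespace WordState
variable {d L : ℕ} {Φ : List (Fin d) → ℝ}

theorem gapConc_nonneg (a n b : ℕ) : 0 ≤ gapConc Φ a n b :=
  Finset.sum_nonneg fun _ _ => conc_nonneg _

theorem gapLinEnt_le_one (h : WordState L Φ) {a n b : ℕ} (hL : a + n + b = L) :
    gapLinEnt Φ a n b ≤ 1 :=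
  (Finset.sum_le_sum fun _ _ => linEnt_gram_le _).trans_eq (h.sum_hsq hL)

theorem gapConc_sq_le (h : WordState L Φ) {a n b : ℕ} (hL : a + n + b = L) :
    gapConc Φ a n b ^ 2 ≤ gapLinEnt Φ a n b := by
  refine (Finset.sum_sq_le_sum_mul_sum_of_sq_le_mul _ (fun _ _ => hsq_nonneg _)
    (fun _ _ => linEnt_gram_nonneg _) fun z _ => (conc_gram_sq _).le).trans_eq ?_
  rw [h.sum_hsq hL, one_mul]
  rfl

theorem sum_trace_left (h : WordState L Φ) {a n b : ℕ} (hL : a + n + b = L) :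
    ∑ z : Fin n → Fin d, (wordMat Φ a b (List.ofFn z) *
      (wordMat Φ a b (List.ofFn z)).transpose).trace = 1 := by
  simpa only [← hsq_eq_trace] using h.sum_hsq hL

theorem sum_trace_right (h : WordState L Φ) {a n b : ℕ} (hL : a + n + b = L) :
    ∑ z : Fin n → Fin d, ((wordMat Φ a b (List.ofFn z)).transpose *
      wordMat Φ a b (List.ofFn z)).trace = 1 := by
  simp only [Matrix.trace_mul_comm (Matrix.transpose _)]
  exact h.sum_trace_left hL

theorem gapLinEnt_le (h : WordState L Φ) {a n₁ n₂ b : ℕ} (hL : a + (n₁ + (n₂ + 1)) + b = L)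
    {ε η : ℝ} (hε : 0 < ε) (hη : 0 < η) (hd : 1024 * (d : ℝ) ^ 8 * η ≤ ε ^ 2) :
    gapLinEnt Φ a (n₁ + (n₂ + 1)) b ≤ ε + (gapLinEnt Φ a n₁ (n₂ + b + 1) +
      gapLinEnt Φ (a + n₁ + 1) n₂ b - 2 * gapLinEnt Φ a (n₁ + (n₂ + 1)) b) / η := by
  have hF : gapLinEnt Φ a (n₁ + (n₂ + 1)) b = ∑ z₁ : Fin n₁ → Fin d, ∑ z₂ : Fin n₂ → Fin d, ∑ s,
      linEnt (wordMat Φ a b (List.ofFn z₁ ++ s :: List.ofFn z₂) *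
        (wordMat Φ a b (List.ofFn z₁ ++ s :: List.ofFn z₂)).transpose) := by
    unfold gapLinEnt
    rw [sum_ofFn_add n₁ (n₂ + 1) fun w => linEnt (wordMat Φ a b w * (wordMat Φ a b w).transpose)]
    refine Finset.sum_congr rfl fun z₁ _ => ?_
    rw [sum_ofFn_succ n₂ fun w => linEnt (wordMat Φ a b (List.ofFn z₁ ++ w) *
      (wordMat Φ a b (List.ofFn z₁ ++ w)).transpose), Finset.sum_comm]
  have h1 := h.sum_trace_left (a := a) (n := n₁) (b := n₂ + b + 1) (by omega)
  have h2 := h.sum_trace_right (a := a + n₁ + 1) (n := n₂) (b := b) (by omega)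
  have key := Finset.sum_le_sum fun (z₁ : Fin n₁ → Fin d) (_ : z₁ ∈ Finset.univ) =>
    Finset.sum_le_sum fun (z₂ : Fin n₂ → Fin d) (_ : z₂ ∈ Finset.univ) =>
      (h.cut_wordMat hL z₁ z₂).sum_linEnt_le hε hη (by simpa using hd)
  simp only [Finset.sum_add_distrib, ← Finset.mul_sum, ← Finset.sum_mul, ← Finset.sum_div,
    Finset.sum_sub_distrib, h1, h2, linEnt_gram_transpose] at key
  rw [← hF] at key
  simpa [gapLinEnt] using key

theorem gapConc_le (h : WordState L Φ) {a n₁ n₂ b : ℕ} (hL : a + (n₁ + (n₂ + 1)) + b = L) :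
    gapConc Φ a (n₁ + (n₂ + 1)) b ≤
      d * (gapConc Φ a n₁ (n₂ + b + 1) * gapConc Φ (a + n₁ + 1) n₂ b) := by
  have hF : gapConc Φ a (n₁ + (n₂ + 1)) b = ∑ z₁ : Fin n₁ → Fin d, ∑ z₂ : Fin n₂ → Fin d, ∑ s,
      conc (wordMat Φ a b (List.ofFn z₁ ++ s :: List.ofFn z₂) *
        (wordMat Φ a b (List.ofFn z₁ ++ s :: List.ofFn z₂)).transpose) := by
    unfold gapConc
    rw [sum_ofFn_add n₁ (n₂ + 1) fun w => conc (wordMat Φ a b w * (wordMat Φ a b w).transpose)]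
    refine Finset.sum_congr rfl fun z₁ _ => ?_
    rw [sum_ofFn_succ n₂ fun w => conc (wordMat Φ a b (List.ofFn z₁ ++ w) *
      (wordMat Φ a b (List.ofFn z₁ ++ w)).transpose), Finset.sum_comm]
  have key := Finset.sum_le_sum fun (z₁ : Fin n₁ → Fin d) (_ : z₁ ∈ Finset.univ) =>
    Finset.sum_le_sum fun (z₂ : Fin n₂ → Fin d) (_ : z₂ ∈ Finset.univ) =>
      (h.cut_wordMat hL z₁ z₂).sum_conc_le
  simp only [← Finset.mul_sum, ← Finset.sum_mul, conc_gram_transpose] at key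
  rw [← hF] at key
  simpa [gapConc] using key

theorem gapLinEnt_le_of_le (h : WordState L Φ) {ε η : ℝ} (hε : 0 < ε) (hη : 0 < η)
    (hd : 1024 * (d : ℝ) ^ 8 * η ≤ ε ^ 2) (k : ℕ) : ∀ {a n b : ℕ}, a + n + b = L → 2 ^ k ≤ n + 1 →
      gapLinEnt Φ a n b ≤ ε + ((1 + η / 2)⁻¹) ^ k := by
  induction k with
  | zero => intro a n b hL _; have := h.gapLinEnt_le_one hL; simp; linarith
  | succ k ih =>
    intro a n b hL hn
    have hk : 1 ≤ 2 ^ k := Nat.one_le_two_pow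
    obtain ⟨n₂, rfl⟩ : ∃ n₂, n = (2 ^ k - 1) + (n₂ + 1) := ⟨n - 2 ^ k, by omega⟩
    have h1 := h.gapLinEnt_le hL hε hη hd
    have h2 := ih (a := a) (n := 2 ^ k - 1) (b := n₂ + b + 1) (by omega) (by omega)
    have h3 := ih (a := a + (2 ^ k - 1) + 1) (n := n₂) (b := b) (by omega) (by omega)
    set δ := ((1 + η / 2)⁻¹) ^ k
    have hδ : ((1 + η / 2)⁻¹) ^ (k + 1) = 2 * δ / (η + 2) := by
      rw [pow_succ]
      change δ * _ = _
      clear_value δ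
      field_simp
      ring
    rw [hδ]
    set F := gapLinEnt Φ a (2 ^ k - 1 + (n₂ + 1)) b
    have h4 : F * η ≤ ε * η + (2 * (ε + δ) - 2 * F) := by
      have : F * η ≤ (ε + (2 * (ε + δ) - 2 * F) / η) * η := by
        refine mul_le_mul_of_nonneg_right (h1.trans ?_) hη.le
        gcongr
        linarith
      rwa [add_mul, div_mul_cancel₀ _ hη.ne'] at this
    have : F - ε ≤ 2 * δ / (η + 2) := by
      rw [le_div_iff₀ (by positivity)]
      linarith
    linarith

end WordState

theorem mutInfo_submatrix {X Y Y' : Type*} [Fintype X] [Fintype Y] [Fintype Y'] (C : Matrix X Y ℝ)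
    (e : Y' ≃ Y) : mutInfo (C.submatrix id e) = mutInfo C := by
  simp only [mutInfo, hsq, Matrix.submatrix_apply, id]
  simp only [fun x => e.sum_comp fun y => C x y ^ 2,
    fun x => e.sum_comp fun y => C x y ^ 2 * Real.log (C x y ^ 2),
    e.sum_comp fun y => (∑ x, C x y ^ 2) * Real.log (∑ x, C x y ^ 2)]

theorem hsq_submatrix {X Y Y' : Type*} [Fintype X] [Fintype Y] [Fintype Y'] (C : Matrix X Y ℝ)
    (e : Y' ≃ Y) : hsq (C.submatrix id e) = hsq C := by
  simp only [hsq, Matrix.submatrix_apply, id, fun x => e.sum_comp fun y => C x y ^ 2]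

namespace WordState
variable {d L : ℕ} {Φ : List (Fin d) → ℝ}

theorem gapConc_le_pow (h : WordState L Φ) {N : ℕ} (hN : 0 < N)
    (hG : ∀ {a n b : ℕ}, a + n + b = L → N ≤ n + 1 → d * gapConc Φ a n b ≤ 1 / 2) (q : ℕ) :
    ∀ {a n b : ℕ}, a + n + b = L → q * N ≤ n → gapConc Φ a n b ≤ (1 / 2) ^ q := by
  induction q with
  | zero =>
    intro a n b hL _
    have h1 := (h.gapConc_sq_le hL).trans (h.gapLinEnt_le_one hL)
    simpa using (abs_le_of_sq_le_sq' (b := (1 : ℝ)) (by simpa using h1) one_pos.le).2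
  | succ q ih =>
    intro a n b hL hn
    rw [add_mul, one_mul] at hn
    obtain ⟨n₂, rfl⟩ : ∃ n₂, n = (N - 1) + (n₂ + 1) := ⟨n - N, by omega⟩
    have h1 := h.gapConc_le hL
    have h2 := hG (a := a) (n := N - 1) (b := n₂ + b + 1) (by omega) (by omega)
    have h3 := ih (a := a + (N - 1) + 1) (n := n₂) (b := b) (by omega) (by omega)
    rw [← mul_assoc] at h1
    refine h1.trans ?_
    rw [pow_succ, mul_comm]
    exact mul_le_mul h3 h2 (mul_nonneg (Nat.cast_nonneg _) (gapConc_nonneg _ _ _)) (by positivity)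

theorem gapMutInfo_zero_le (h : WordState L Φ) (hd : 0 < d) {a b : ℕ} (hL : a + (b + 1) = L) :
    gapMutInfo Φ a 0 (b + 1) ≤ Real.log d := by
  have hc := h.cut_wordMat (a := a) (n₁ := 0) (n₂ := 0) (b := b) (by omega) Fin.elim0 Fin.elim0
  have h1 := h.sum_hsq (a := a) (n := 0) (b := b + 1) (by omega)
  have h2 := h.sum_trace_right (a := a + 0 + 1) (n := 0) (b := b) (by omega)
  simp only [Fintype.sum_unique] at h1 h2
  have key := hc.mutInfo_le_log_card (by
      rw [show (Fin.elim0 : Fin 0 → Fin d) = default from Subsingleton.elim _ _, h2]; exact one_pos)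
    (by simpa using hd)
    ((wordMat Φ a (b + 1) []).submatrix id (Fin.consEquiv fun _ => Fin d))
    (fun x s y => by simp [wordMat, Fin.consEquiv])
  rw [mutInfo_submatrix, hsq_submatrix] at key
  simp only [List.ofFn_zero] at h1
  rw [h1, one_mul] at key
  simpa [gapMutInfo] using key

theorem gapMutInfo_le_of_le {a n b : ℕ} {f : List (Fin d) → ℝ}
    (hf : ∀ s (z : Fin n → Fin d),
      mutInfo (wordMat Φ a b (s :: List.ofFn z)) ≤ f (s :: List.ofFn z)) :
    gapMutInfo Φ a (n + 1) b ≤ ∑ z : Fin (n + 1) → Fin d, f (List.ofFn z) := by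
  unfold gapMutInfo
  rw [sum_ofFn_succ n f, sum_ofFn_succ n fun w => mutInfo (wordMat Φ a b w)]
  exact Finset.sum_le_sum fun s _ => Finset.sum_le_sum fun z _ => hf s z

theorem gapMutInfo_le_half_log (h : WordState L Φ) (hd : 0 < d) {a n b : ℕ}
    (hL : a + (n + 1) + b = L) : gapMutInfo Φ a (n + 1) b ≤ 1 / 2 * Real.log d := by
  refine (gapMutInfo_le_of_le (f := fun w => hsq (wordMat Φ a b w) * (1 / 2 * Real.log d))
    fun s z => ?_).trans_eq ?_
  · have := (h.cut_wordMat (a := a) (n₁ := 0) (n₂ := n) (b := b) (by omega) Fin.elim0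
      z).mutInfo_le_half_log (by simpa using hd) s
    simpa using this
  · rw [← Finset.sum_mul, h.sum_hsq hL, one_mul]

theorem gapMutInfo_le_conc (h : WordState L Φ) {a n b : ℕ} (hL : a + (n + 1) + b = L) :
    gapMutInfo Φ a (n + 1) b ≤ 2 * √(2 * √d) * gapConc Φ a (n + 1) b := by
  refine (gapMutInfo_le_of_le (f := fun w => 2 * √(2 * √d) *
    conc (wordMat Φ a b w * (wordMat Φ a b w).transpose)) fun s z => ?_).trans_eq ?_
  · have := (h.cut_wordMat (a := a) (n₁ := 0) (n₂ := n) (b := b) (by omega) Fin.elim0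
      z).mutInfo_le_mul_conc s
    simpa using this
  · rw [← Finset.mul_sum]; rfl

end WordState

/-- The concurrence across a long enough gap is uniformly small. -/
theorem exists_gapConc_le {d : ℕ} (hd : 0 < d) : ∃ N : ℕ, 0 < N ∧
    ∀ {L : ℕ} {Φ : List (Fin d) → ℝ}, WordState L Φ → ∀ {a n b : ℕ}, a + n + b = L → N ≤ n + 1 →
      d * gapConc Φ a n b ≤ 1 / 2 := by
  have hd' : (0 : ℝ) < d := by exact_mod_cast hd
  set ε : ℝ := 1 / (8 * d ^ 2) with hε
  have hε0 : 0 < ε := by positivity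
  set η : ℝ := ε ^ 2 / (1024 * d ^ 8) with hη
  have hη0 : 0 < η := by positivity
  obtain ⟨k, hk⟩ := exists_pow_lt_of_lt_one hε0
    (inv_lt_one_of_one_lt₀ (by linarith : 1 < 1 + η / 2))
  refine ⟨2 ^ k, by positivity, fun {L Φ} h {a n b} hL hn => ?_⟩
  have h1 := h.gapLinEnt_le_of_le hε0 hη0 (by rw [hη]; field_simp; rfl) k hL hn
  have h2 := h.gapConc_sq_le hL
  refine (abs_le_of_sq_le_sq' ?_ (by norm_num)).2
  calc (d * gapConc Φ a n b) ^ 2 = d ^ 2 * gapConc Φ a n b ^ 2 := by ring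
    _ ≤ d ^ 2 * (ε + ε) := by gcongr; linarith
    _ = (1 / 2) ^ 2 := by rw [hε]; field_simp; norm_num

theorem exists_pow_ge (N : ℕ) (hN : 0 < N) (Q : ℕ) : ∃ c : ℝ, 0 ≤ c ∧ c < 1 ∧
    ∀ n, 1 / 2 ≤ c ^ n ∨ (1 / 2 : ℝ) ^ (n / N) ≤ (1 / 2) ^ Q * c ^ n := by
  set T := Q + 2 with hT
  have hM : N * T ≠ 0 := by positivity
  refine ⟨(1 / 2 : ℝ) ^ (1 / ((N * T : ℕ) : ℝ)), by positivity,
    Real.rpow_lt_one (by norm_num) (by norm_num) (by positivity), fun n => ?_⟩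
  set c := (1 / 2 : ℝ) ^ (1 / ((N * T : ℕ) : ℝ)) with hc
  have hcM : c ^ (N * T) = 1 / 2 := by
    rw [hc, one_div ((N * T : ℕ) : ℝ)]
    exact Real.rpow_inv_natCast_pow (by norm_num) hM
  have hc0 : 0 ≤ c := by positivity
  have hc1 : c ≤ 1 := Real.rpow_le_one (by norm_num) (by norm_num) (by positivity)
  rcases le_or_gt n (N * T) with hn | hn
  · left
    rw [← hcM]
    exact pow_le_pow_of_le_one hc0 hc1 hn
  · right
    have h1 : n ≤ N * T * (n / (N * T) + 1) := (Nat.lt_mul_div_succ n (by positivity)).le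
    have h2 : (1 / 2 : ℝ) ^ (n / (N * T) + 1) ≤ c ^ n := by
      rw [← hcM, ← pow_mul]
      exact pow_le_pow_of_le_one hc0 hc1 h1
    refine le_trans ?_ (mul_le_mul_of_nonneg_left h2 (by positivity))
    rw [← pow_add]
    refine pow_le_pow_of_le_one (by norm_num) (by norm_num) ?_
    rw [← Nat.div_div_eq_div_mul]
    have h3 : T ≤ n / N := (Nat.le_div_iff_mul_le hN).2 (by rw [mul_comm]; exact hn.le)
    have h4 := Nat.div_add_mod (n / N) T
    have h5 : 1 ≤ n / N / T := (Nat.le_div_iff_mul_le (by omega)).2 (by simpa using h3)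
    have h6 := Nat.mul_le_mul_left (Q + 1) h5
    have h7 : T * (n / N / T) = (Q + 1) * (n / N / T) + n / N / T := by rw [hT]; ring
    omega

/-- The conditional mutual information across a gap decays exponentially. -/
theorem exists_gapMutInfo_le {d : ℕ} (hd : 0 < d) : ∃ c : ℝ, 0 ≤ c ∧ c < 1 ∧
    ∀ {L : ℕ} {Φ : List (Fin d) → ℝ}, WordState L Φ → ∀ {a n b : ℕ}, a + n + (b + 1) = L →
      gapMutInfo Φ a n (b + 1) ≤ c ^ n * Real.log d := by
  obtain ⟨N, hN, hG⟩ := exists_gapConc_le hd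
  obtain ⟨Q, hQ⟩ : ∃ Q : ℕ, d = 1 ∨ 2 * √(2 * √d) * (1 / 2) ^ Q ≤ Real.log d := by
    rcases Nat.eq_or_lt_of_le hd with h1 | h1
    · exact ⟨0, Or.inl h1.symm⟩
    · have hlog : 0 < Real.log d := Real.log_pos (by exact_mod_cast h1)
      obtain ⟨Q, hQ⟩ := exists_pow_lt_of_lt_one
        (div_pos hlog (by positivity : 0 < 2 * √(2 * √(d : ℝ)))) (by norm_num : (1 / 2 : ℝ) < 1)
      refine ⟨Q, Or.inr ?_⟩
      rw [lt_div_iff₀ (by positivity)] at hQ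
      linarith
  obtain ⟨c, hc0, hc1, hc⟩ := exists_pow_ge N hN Q
  refine ⟨c, hc0, hc1, fun {L Φ} h {a n b} hL => ?_⟩
  have hlog : 0 ≤ Real.log d := Real.log_natCast_nonneg d
  rcases n with - | n
  · simpa using h.gapMutInfo_zero_le hd (a := a) (b := b) (by omega)
  have h1 := h.gapMutInfo_le_half_log hd hL
  rcases hQ with rfl | hQ
  · simpa using h1
  rcases hc (n + 1) with h2 | h2
  · exact h1.trans (mul_le_mul_of_nonneg_right h2 hlog)
  · have h3 := h.gapConc_le_pow hN (hG h) ((n + 1) / N) hL (Nat.div_mul_le_self _ _)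
    calc gapMutInfo Φ a (n + 1) (b + 1) ≤ 2 * √(2 * √d) * gapConc Φ a (n + 1) (b + 1) :=
          h.gapMutInfo_le_conc hL
      _ ≤ 2 * √(2 * √d) * ((1 / 2) ^ Q * c ^ (n + 1)) := by gcongr; exact h3.trans h2
      _ = 2 * √(2 * √d) * (1 / 2) ^ Q * c ^ (n + 1) := by ring
      _ ≤ Real.log d * c ^ (n + 1) := by gcongr
      _ = _ := mul_comm _ _

theorem sum_sumArrow {d : ℕ} {ι κ : Type*} [Fintype ι] [Fintype κ] [DecidableEq ι]
    [DecidableEq κ] {M : Type*} [AddCommMonoid M] (f : (ι ⊕ κ → Fin d) → M) :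
    ∑ w, f w = ∑ x, ∑ y, f (Sum.elim x y) := by
  rw [← Fintype.sum_prod_type', ← (Equiv.sumArrowEquivProdArrow ι κ (Fin d)).symm.sum_comp]
  rfl

theorem exists_equiv_left {V α β : Type*} {p : V → Prop} (E : V ≃ α ⊕ β)
    (hp : ∀ k, p k ↔ (E k).isLeft) :
    ∃ e : {k // p k} ≃ α, ∀ k : {k // p k}, E k = Sum.inl (e k) := by
  refine ⟨⟨fun k => (E k).getLeft ((hp k).1 k.2), fun i => ⟨E.symm (Sum.inl i), by simp [hp]⟩,
    fun k => by simp, fun i => by simp⟩, fun k => by simp⟩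

theorem exists_equiv_right {V α β : Type*} {p : V → Prop} (E : V ≃ α ⊕ β)
    (hp : ∀ k, p k ↔ (E k).isLeft) :
    ∃ e : {k // ¬ p k} ≃ β, ∀ k : {k // ¬ p k}, E k = Sum.inr (e k) := by
  obtain ⟨e, he⟩ := exists_equiv_left (p := fun k => ¬ p k) (E.trans (Equiv.sumComm α β))
    (fun k => by simp [hp])
  exact ⟨e, fun k => by simpa using congrArg Sum.swap (he k)⟩

theorem exists_glue_eq {L d : ℕ} {ι κ : Type*} (E : Fin L ≃ ι ⊕ κ) {R : Finset (Fin L)}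
    (hR : ∀ k, k ∈ R ↔ (E k).isLeft) :
    ∃ (e : {k // k ∈ R} ≃ ι) (e' : {k // k ∉ R} ≃ κ), (∀ k : {k // k ∈ R}, E k = Sum.inl (e k)) ∧
      ∀ (x : ι → Fin d) (w : κ → Fin d), glue R (x ∘ e) (w ∘ e') = fun k => Sum.elim x w (E k) := by
  obtain ⟨e, he⟩ := exists_equiv_left E hR
  obtain ⟨e', he'⟩ := exists_equiv_right E hR
  refine ⟨e, e', he, fun x w => funext fun k => ?_⟩
  by_cases hk : k ∈ R
  · simp [glue, hk, he ⟨k, hk⟩]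
  · simp [glue, hk, he' ⟨k, hk⟩]

theorem margEnt_eq {L d : ℕ} {ι κ : Type*} [Fintype ι] [Fintype κ] [DecidableEq ι] [DecidableEq κ]
    (E : Fin L ≃ ι ⊕ κ) {R : Finset (Fin L)}
    (hR : ∀ k, k ∈ R ↔ (E k).isLeft)
    (P : (Fin L → Fin d) → ℝ) :
    margEnt P R = -∑ x : ι → Fin d, (∑ w : κ → Fin d, P fun k => Sum.elim x w (E k)) *
      Real.log (∑ w : κ → Fin d, P fun k => Sum.elim x w (E k)) := by
  obtain ⟨e, e', -, h⟩ := exists_glue_eq (d := d) E hR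
  unfold margEnt
  rw [← (e.symm.arrowCongr (Equiv.refl (Fin d))).sum_comp]
  simp only [← (e'.symm.arrowCongr (Equiv.refl (Fin d))).sum_comp fun μ => P (glue R _ μ), ← h]
  rfl

theorem rhoR_eq {L d : ℕ} {ι κ : Type*} [Fintype κ] [DecidableEq κ] (E : Fin L ≃ ι ⊕ κ)
    {R : Finset (Fin L)} (hR : ∀ k, k ∈ R ↔ (E k).isLeft)
    (Ψ : (Fin L → Fin d) → ℂ) {σ σ' : Fin L → Fin d} {x x' : ι → Fin d} {y y' : κ → Fin d}
    (hσ : σ = fun k => Sum.elim x y (E k)) (hσ' : σ' = fun k => Sum.elim x' y' (E k)) :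
    rhoR Ψ R (fun k => σ k) (fun k => σ' k) = ∑ w : κ → Fin d,
      Ψ (fun k => Sum.elim x w (E k)) * (starRingEnd ℂ) (Ψ fun k => Sum.elim x' w (E k)) := by
  obtain ⟨e, e', he, h⟩ := exists_glue_eq (d := d) E hR
  have h1 : (fun k : {k // k ∈ R} => σ k) = x ∘ e := by ext k; simp [hσ, he]
  have h2 : (fun k : {k // k ∈ R} => σ' k) = x' ∘ e := by ext k; simp [hσ', he]
  rw [h1, h2, rhoR, Matrix.of_apply, ← (e'.symm.arrowCongr (Equiv.refl (Fin d))).sum_comp]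
  simp only [← h]
  rfl

/-- The three consecutive blocks of a line of `a + n + b` sites. -/
def blockEquiv (a n b : ℕ) : Fin (a + n + b) ≃ (Fin a ⊕ Fin n) ⊕ Fin b :=
  finSumFinEquiv.symm.trans (Equiv.sumCongr finSumFinEquiv.symm (Equiv.refl _))

theorem append_append_eq {d a n b : ℕ} (x : Fin a → Fin d) (z : Fin n → Fin d) (y : Fin b → Fin d) :
    Fin.append (Fin.append x z) y = fun k => Sum.elim (Sum.elim x z) y (blockEquiv a n b k) := by
  funext k
  obtain ⟨p, rfl⟩ := (blockEquiv a n b).symm.surjective k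
  rcases p with (i | i) | i <;> simp [blockEquiv]

theorem forall_mem_iff_blockEquiv {a n b : ℕ} {p q : Fin (a + n + b) → Prop}
    (h₁ : ∀ i : Fin a, p (Fin.castAdd b (Fin.castAdd n i)) ↔ q (Fin.castAdd b (Fin.castAdd n i)))
    (h₂ : ∀ i : Fin n, p (Fin.castAdd b (Fin.natAdd a i)) ↔ q (Fin.castAdd b (Fin.natAdd a i)))
    (h₃ : ∀ i : Fin b, p (Fin.natAdd (a + n) i) ↔ q (Fin.natAdd (a + n) i)) (k) : p k ↔ q k := by
  induction k using Fin.addCases with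
  | left k => induction k using Fin.addCases with
    | left k => exact h₁ k
    | right k => exact h₂ k
  | right k => exact h₃ k

/-- The real amplitudes of `Ψ` as a function on words. -/
noncomputable def wordAmp {L d : ℕ} (Ψ : (Fin L → Fin d) → ℂ) (l : List (Fin d)) : ℝ :=
  if h : l.length = L then (Ψ fun k => l.get (k.cast h.symm)).re else 0

theorem wordAmp_ofFn {L d : ℕ} (Ψ : (Fin L → Fin d) → ℂ) (σ : Fin L → Fin d) :
    wordAmp Ψ (List.ofFn σ) = (Ψ σ).re := by
  simp [wordAmp]

theorem wordAmp_block {d a n b : ℕ} (Ψ : (Fin (a + n + b) → Fin d) → ℂ) (x : Fin a → Fin d)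
    (z : Fin n → Fin d) (y : Fin b → Fin d) :
    wordAmp Ψ (List.ofFn x ++ List.ofFn z ++ List.ofFn y) =
      (Ψ (Fin.append (Fin.append x z) y)).re := by
  rw [← wordAmp_ofFn, List.ofFn_fin_append, List.ofFn_fin_append]

theorem sum_mul_conj_eq {d a b : ℕ} {Ψ : (Fin (a + 1 + b) → Fin d) → ℂ} (hd : 0 < d)
    (h : ZeroCorr Ψ) (u u' : Fin a → Fin d) (v v' : Fin b → Fin d) :
    ∑ t : Fin 1 → Fin d, Ψ (Fin.append (Fin.append u t) v) *
        (starRingEnd ℂ) (Ψ (Fin.append (Fin.append u' t) v')) =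
      (∑ t : Fin 1 → Fin d, ∑ y, Ψ (Fin.append (Fin.append u t) y) *
        (starRingEnd ℂ) (Ψ (Fin.append (Fin.append u' t) y))) *
      ∑ x, ∑ t : Fin 1 → Fin d, Ψ (Fin.append (Fin.append x t) v) *
        (starRingEnd ℂ) (Ψ (Fin.append (Fin.append x t) v')) := by
  set E₁ : Fin (a + 1 + b) ≃ (Fin a ⊕ Fin b) ⊕ Fin 1 := (blockEquiv a 1 b).trans
    (((Equiv.sumAssoc _ _ _).trans (Equiv.sumCongr (Equiv.refl _) (Equiv.sumComm _ _))).trans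
      (Equiv.sumAssoc _ _ _).symm) with hE₁
  set E₂ : Fin (a + 1 + b) ≃ Fin a ⊕ (Fin 1 ⊕ Fin b) :=
    (blockEquiv a 1 b).trans (Equiv.sumAssoc _ _ _) with hE₂
  set E₃ : Fin (a + 1 + b) ≃ Fin b ⊕ (Fin a ⊕ Fin 1) :=
    (blockEquiv a 1 b).trans (Equiv.sumComm _ _) with hE₃
  have e₁ : ∀ (x : Fin a → Fin d) (t : Fin 1 → Fin d) (y : Fin b → Fin d),
      Fin.append (Fin.append x t) y = fun k => Sum.elim (Sum.elim x y) t (E₁ k) := by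
    intro x t y
    rw [append_append_eq]
    funext k
    rcases hk : blockEquiv a 1 b k with (i | i) | i <;> simp [E₁, hk]
  have e₂ : ∀ (x : Fin a → Fin d) (t : Fin 1 → Fin d) (y : Fin b → Fin d),
      Fin.append (Fin.append x t) y = fun k => Sum.elim x (Sum.elim t y) (E₂ k) := by
    intro x t y
    rw [append_append_eq]
    funext k
    rcases hk : blockEquiv a 1 b k with (i | i) | i <;> simp [E₂, hk]
  have e₃ : ∀ (x : Fin a → Fin d) (t : Fin 1 → Fin d) (y : Fin b → Fin d),
      Fin.append (Fin.append x t) y = fun k => Sum.elim y (Sum.elim x t) (E₃ k) := by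
    intro x t y
    rw [append_append_eq]
    funext k
    rcases hk : blockEquiv a 1 b k with (i | i) | i <;> simp [E₃, hk]
  set A : Finset (Fin (a + 1 + b)) := Finset.univ.filter fun k => (k : ℕ) < a with hA
  set B : Finset (Fin (a + 1 + b)) := Finset.univ.filter fun k => a < (k : ℕ) with hB
  have h₁ : ∀ k, k ∈ A ∪ B ↔ (E₁ k).isLeft := by
    apply forall_mem_iff_blockEquiv <;> intro i <;> simp [A, B, E₁, blockEquiv]
    omega
  have h₂ : ∀ k, k ∈ A ↔ (E₂ k).isLeft := by
    apply forall_mem_iff_blockEquiv <;> intro i <;> simp [A, E₂, blockEquiv]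
    omega
  have h₃ : ∀ k, k ∈ B ↔ (E₃ k).isLeft := by
    apply forall_mem_iff_blockEquiv <;> intro i <;> simp [B, E₃, blockEquiv]
    omega
  let t₀ : Fin 1 → Fin d := fun _ => ⟨0, hd⟩
  have key := h A B (fun k hk l hl => by
      simp only [A, B, Finset.mem_filter, Finset.mem_univ, true_and] at hk hl
      rw [abs_sub_comm]
      exact le_trans (by omega) (le_abs_self _))
    (fun k => Fin.append (Fin.append u t₀) v k) (fun k => Fin.append (Fin.append u' t₀) v' k)
  rw [rhoR_eq E₁ h₁ Ψ (e₁ u t₀ v) (e₁ u' t₀ v'), rhoR_eq E₂ h₂ Ψ (e₂ u t₀ v) (e₂ u' t₀ v'),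
    rhoR_eq E₃ h₃ Ψ (e₃ u t₀ v) (e₃ u' t₀ v'), sum_sumArrow, sum_sumArrow] at key
  simpa only [← e₁, ← e₂, ← e₃] using key

theorem wordState_wordAmp {L d : ℕ} {Ψ : (Fin L → Fin d) → ℂ} (hd : 0 < d) (h₁ : NormalizedLine Ψ)
    (h₂ : NonNegLine Ψ) (h₃ : ZeroCorr Ψ) : WordState L (wordAmp Ψ) where
  nonneg w := by
    unfold wordAmp
    split_ifs
    exacts [(h₂ _).1, le_rfl]
  norm := by
    rw [← h₁]
    refine Finset.sum_congr rfl fun σ _ => ?_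
    rw [wordAmp_ofFn, Complex.normSq_apply, (h₂ σ).2]
    ring
  cut m k hL u u' v v' := by
    subst hL
    have hre : ∀ σ σ', Ψ σ * (starRingEnd ℂ) (Ψ σ') = (((Ψ σ).re * (Ψ σ').re : ℝ) : ℂ) := by
      intro σ σ'
      apply Complex.ext <;> simp [(h₂ σ).2, (h₂ σ').2]
    have key := sum_mul_conj_eq hd h₃ u u' v v'
    simp only [hre, ← wordAmp_block] at key
    norm_cast at key
    rw [sum_ofFn_add m 1 fun w => wordAmp Ψ (w ++ List.ofFn v) * wordAmp Ψ (w ++ List.ofFn v'),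
      sum_ofFn_succ k fun w => wordAmp Ψ (List.ofFn u ++ w) * wordAmp Ψ (List.ofFn u' ++ w)]
    have hs : ∀ f : List (Fin d) → ℝ, ∑ t : Fin 1 → Fin d, f (List.ofFn t) = ∑ s, f [s] := by
      intro f
      rw [sum_ofFn_succ 0 f]
      simp
    rw [hs fun t => wordAmp Ψ (List.ofFn u ++ t ++ List.ofFn v) *
        wordAmp Ψ (List.ofFn u' ++ t ++ List.ofFn v'),
      hs fun t => ∑ y : Fin k → Fin d, wordAmp Ψ (List.ofFn u ++ t ++ List.ofFn y) *
        wordAmp Ψ (List.ofFn u' ++ t ++ List.ofFn y)] at key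
    simpa using key

theorem gapMutInfo_wordAmp {d a n b : ℕ} {Ψ : (Fin (a + n + b) → Fin d) → ℂ} (h : NonNegLine Ψ)
    {X Y Z : Finset (Fin (a + n + b))} (hX : ∀ k, k ∈ X ↔ (k : ℕ) < a)
    (hY : ∀ k, k ∈ Y ↔ a + n ≤ (k : ℕ)) (hZ : ∀ k, k ∈ Z ↔ a ≤ (k : ℕ) ∧ (k : ℕ) < a + n) :
    gapMutInfo (wordAmp Ψ) a n b =
      margEnt (fun σ => Complex.normSq (Ψ σ)) (X ∪ Z) +
        margEnt (fun σ => Complex.normSq (Ψ σ)) (Y ∪ Z) -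
        margEnt (fun σ => Complex.normSq (Ψ σ)) (X ∪ Y ∪ Z) -
        margEnt (fun σ => Complex.normSq (Ψ σ)) Z := by
  set E := blockEquiv a n b with hE
  set E₁ := E.trans ((Equiv.sumAssoc _ _ _).trans (Equiv.sumComm _ _)) with hE₁
  set E₂ := E.trans (Equiv.sumEmpty _ Empty).symm with hE₂
  set E₃ := E.trans ((Equiv.sumCongr (Equiv.sumComm _ _) (Equiv.refl _)).trans
    (Equiv.sumAssoc _ _ _)) with hE₃
  have h₀ : ∀ k, k ∈ X ∪ Z ↔ (E k).isLeft := by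
    apply forall_mem_iff_blockEquiv <;> intro i <;> simp [hX, hZ, E, blockEquiv]
    omega
  have h₁ : ∀ k, k ∈ Y ∪ Z ↔ (E₁ k).isLeft := by
    apply forall_mem_iff_blockEquiv <;> intro i <;> simp [hY, hZ, E₁, E, blockEquiv]
    omega
  have h₂ : ∀ k, k ∈ X ∪ Y ∪ Z ↔ (E₂ k).isLeft := by
    apply forall_mem_iff_blockEquiv <;> intro i <;> simp [hX, hY, hZ, E₂, E, blockEquiv]
  have h₃ : ∀ k, k ∈ Z ↔ (E₃ k).isLeft := by
    apply forall_mem_iff_blockEquiv <;> intro i <;> simp [hZ, E₃, E, blockEquiv]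
  have e₀ := fun x z y => append_append_eq (d := d) (a := a) (n := n) (b := b) x z y
  have e₁ : ∀ (x : Fin a → Fin d) (z : Fin n → Fin d) (y : Fin b → Fin d),
      (fun k => Sum.elim (Sum.elim z y) x (E₁ k)) = Fin.append (Fin.append x z) y := by
    intro x z y
    rw [append_append_eq]
    funext k
    rcases hk : E k with (i | i) | i <;> simp [E₁, hk]
  have e₂ : ∀ (x : Fin a → Fin d) (z : Fin n → Fin d) (y : Fin b → Fin d) (w : Empty → Fin d),
      (fun k => Sum.elim (Sum.elim (Sum.elim x z) y) w (E₂ k)) =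
        Fin.append (Fin.append x z) y := by
    intro x z y w
    rw [append_append_eq]
    funext k
    simp [E₂, ← hE]
  have e₃ : ∀ (x : Fin a → Fin d) (z : Fin n → Fin d) (y : Fin b → Fin d),
      (fun k => Sum.elim z (Sum.elim x y) (E₃ k)) = Fin.append (Fin.append x z) y := by
    intro x z y
    rw [append_append_eq]
    funext k
    rcases hk : E k with (i | i) | i <;> simp [E₃, hk]
  have hp : ∀ σ, Complex.normSq (Ψ σ) = (Ψ σ).re ^ 2 := by
    intro σ
    rw [Complex.normSq_apply, (h σ).2]
    ring
  rw [margEnt_eq E h₀, margEnt_eq E₁ h₁, margEnt_eq E₂ h₂, margEnt_eq E₃ h₃]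
  simp only [sum_sumArrow, Fintype.sum_unique, e₁, e₂, e₃, hE, ← e₀, hp, ← wordAmp_block]
  simp only [gapMutInfo, mutInfo, hsq, wordMat, Matrix.of_apply, Finset.sum_add_distrib,
    Finset.sum_sub_distrib]
  rw [Finset.sum_comm (f := fun (x : Fin a → Fin d) (z : Fin n → Fin d) =>
    (∑ y : Fin b → Fin d, wordAmp Ψ (List.ofFn x ++ List.ofFn z ++ List.ofFn y) ^ 2) *
      Real.log (∑ y : Fin b → Fin d, wordAmp Ψ (List.ofFn x ++ List.ofFn z ++ List.ofFn y) ^ 2)),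
    Finset.sum_comm (f := fun (x : Fin a → Fin d) (z : Fin n → Fin d) =>
    ∑ y : Fin b → Fin d, wordAmp Ψ (List.ofFn x ++ List.ofFn z ++ List.ofFn y) ^ 2 *
      Real.log (wordAmp Ψ (List.ofFn x ++ List.ofFn z ++ List.ofFn y) ^ 2))]
  ring

theorem stmt16 (d : ℕ) :
    ∃ c : ℝ, 0 ≤ c ∧ c < 1 ∧
      ∀ (L : ℕ) (Ψ : (Fin L → Fin d) → ℂ),
        NormalizedLine Ψ → NonNegLine Ψ → ZeroCorr Ψ →
        ∀ i j : Fin L, i < j →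
          margEnt (fun σ => Complex.normSq (Ψ σ))
              ((Finset.univ.filter fun k => k ≤ i) ∪ (Finset.univ.filter fun k => i < k ∧ k < j)) +
            margEnt (fun σ => Complex.normSq (Ψ σ))
              ((Finset.univ.filter fun k => j ≤ k) ∪ (Finset.univ.filter fun k => i < k ∧ k < j)) -
            margEnt (fun σ => Complex.normSq (Ψ σ))
              ((Finset.univ.filter fun k => k ≤ i) ∪ (Finset.univ.filter fun k => j ≤ k) ∪
                (Finset.univ.filter fun k => i < k ∧ k < j)) -
            margEnt (fun σ => Complex.normSq (Ψ σ))
              (Finset.univ.filter fun k => i < k ∧ k < j) ≤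
          c ^ ((j : ℕ) - (i : ℕ) - 1) * Real.log d := by
  rcases Nat.eq_zero_or_pos d with rfl | hd
  · exact ⟨0, le_rfl, one_pos, fun L Ψ h₁ _ _ i j _ => by
      have : IsEmpty (Fin L → Fin 0) := ⟨fun σ => (σ i).elim0⟩
      simp [NormalizedLine] at h₁⟩
  obtain ⟨c, hc0, hc1, hc⟩ := exists_gapMutInfo_le hd
  refine ⟨c, hc0, hc1, fun L Ψ h₁ h₂ h₃ i j hij => ?_⟩
  obtain ⟨a, ha⟩ : ∃ a, a = (i : ℕ) + 1 := ⟨_, rfl⟩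
  obtain ⟨n, hn⟩ : ∃ n, (j : ℕ) = a + n := ⟨j - (i + 1), by omega⟩
  obtain ⟨b, rfl⟩ : ∃ b, L = a + n + (b + 1) := ⟨L - j - 1, by omega⟩
  have key := hc (wordState_wordAmp hd h₁ h₂ h₃) (a := a) (n := n) (b := b) rfl
  rw [gapMutInfo_wordAmp h₂ (X := Finset.univ.filter fun k => k ≤ i)
    (Y := Finset.univ.filter fun k => j ≤ k) (Z := Finset.univ.filter fun k => i < k ∧ k < j)
    (fun k => by rw [Finset.mem_filter_univ, Fin.le_def]; omega)
    (fun k => by rw [Finset.mem_filter_univ, Fin.le_def]; omega)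
    (fun k => by rw [Finset.mem_filter_univ, Fin.lt_def, Fin.lt_def]; omega)] at key
  rwa [show (j : ℕ) - i - 1 = n by omega]
end

section
/- Let ψ be a tripartite pure state on systems A, B, C with local dimensions d_A, d_B, d_C. Then ρ_AC = ρ_A ⊗ ρ_C if and only if there exist dimensions d_{BL}, d_{BR}, a linear isometry V : ℂ^{d_{BL}} ⊗ ℂ^{d_{BR}} → ℂ^{d_B}, and unit vectors ψ₁ ∈ ℂ^{d_A} ⊗ ℂ^{d_{BL}} and ψ₂ ∈ ℂ^{d_{BR}} ⊗ ℂ^{d_C} such that ψ(i,j,k) = Σ_{l,r} ψ₁(i,l) · ψ₂(r,k) · V_{j,(l,r)}, i.e., ψ is obtained from the product state ψ₁ ⊗ ψ₂ by embedding the two middle factors into system B via V. -/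
open Matrix
open scoped BigOperators Kronecker

noncomputable def rhoA {dA dB dC : ℕ} (ψ : Fin dA × Fin dB × Fin dC → ℂ) :
    Matrix (Fin dA) (Fin dA) ℂ :=
  Matrix.of fun i i' => ∑ j : Fin dB, ∑ k : Fin dC,
    ψ (i, j, k) * (starRingEnd ℂ) (ψ (i', j, k))

noncomputable def rhoC {dA dB dC : ℕ} (ψ : Fin dA × Fin dB × Fin dC → ℂ) :
    Matrix (Fin dC) (Fin dC) ℂ :=
  Matrix.of fun k k' => ∑ i : Fin dA, ∑ j : Fin dB,
    ψ (i, j, k) * (starRingEnd ℂ) (ψ (i, j, k'))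

noncomputable def rhoAC {dA dB dC : ℕ} (ψ : Fin dA × Fin dB × Fin dC → ℂ) :
    Matrix (Fin dA × Fin dC) (Fin dA × Fin dC) ℂ :=
  Matrix.of fun p q => ∑ j : Fin dB, ψ (p.1, j, p.2) * (starRingEnd ℂ) (ψ (q.1, j, q.2))

def Normalized {dA dB dC : ℕ} (ψ : Fin dA × Fin dB × Fin dC → ℂ) : Prop :=
  ∑ i : Fin dA, ∑ j : Fin dB, ∑ k : Fin dC, Complex.normSq (ψ (i, j, k)) = 1

open scoped ComplexOrder

/-- The amplitudes of a tripartite state, as a matrix from `B` to `A × C`. -/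
def amplitudeMatrix {dA dB dC : ℕ} (ψ : Fin dA × Fin dB × Fin dC → ℂ) :
    Matrix (Fin dA × Fin dC) (Fin dB) ℂ :=
  Matrix.of fun p j => ψ (p.1, j, p.2)

theorem rhoAC_eq_mul_conjTranspose {dA dB dC : ℕ} (ψ : Fin dA × Fin dB × Fin dC → ℂ) :
    rhoAC ψ = amplitudeMatrix ψ * (amplitudeMatrix ψ)ᴴ := by
  ext p q
  simp [rhoAC, amplitudeMatrix, Matrix.mul_apply]

theorem rhoA_apply_eq_sum_rhoAC {dA dB dC : ℕ} (ψ : Fin dA × Fin dB × Fin dC → ℂ)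
    (i i' : Fin dA) : rhoA ψ i i' = ∑ k, rhoAC ψ (i, k) (i', k) := by
  simp only [rhoA, rhoAC, Matrix.of_apply]
  exact Finset.sum_comm

theorem rhoC_apply_eq_sum_rhoAC {dA dB dC : ℕ} (ψ : Fin dA × Fin dB × Fin dC → ℂ)
    (k k' : Fin dC) : rhoC ψ k k' = ∑ i, rhoAC ψ (i, k) (i, k') := by
  simp only [rhoC, rhoAC, Matrix.of_apply]

theorem posSemidef_rhoA {dA dB dC : ℕ} (ψ : Fin dA × Fin dB × Fin dC → ℂ) :
    (rhoA ψ).PosSemidef := by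
  have h : rhoA ψ = (Matrix.of fun i (p : Fin dB × Fin dC) => ψ (i, p.1, p.2)) *
      (Matrix.of fun i (p : Fin dB × Fin dC) => ψ (i, p.1, p.2))ᴴ := by
    ext i i'
    simp [rhoA, Matrix.mul_apply, Fintype.sum_prod_type]
  rw [h]
  exact Matrix.posSemidef_self_mul_conjTranspose _

theorem posSemidef_rhoC {dA dB dC : ℕ} (ψ : Fin dA × Fin dB × Fin dC → ℂ) :
    (rhoC ψ).PosSemidef := by
  have h : rhoC ψ = (Matrix.of fun k (p : Fin dA × Fin dB) => ψ (p.1, p.2, k)) *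
      (Matrix.of fun k (p : Fin dA × Fin dB) => ψ (p.1, p.2, k))ᴴ := by
    ext i i'
    simp [rhoC, Matrix.mul_apply, Fintype.sum_prod_type]
  rw [h]
  exact Matrix.posSemidef_self_mul_conjTranspose _

theorem trace_rhoA {dA dB dC : ℕ} (ψ : Fin dA × Fin dB × Fin dC → ℂ)
    (h : Normalized ψ) : (rhoA ψ).trace = 1 := by
  have h' := congrArg (fun x : ℝ => (x : ℂ)) h
  simpa [Matrix.trace, rhoA, Complex.mul_conj] using h'

theorem trace_rhoC {dA dB dC : ℕ} (ψ : Fin dA × Fin dB × Fin dC → ℂ)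
    (h : Normalized ψ) : (rhoC ψ).trace = 1 := by
  rw [← trace_rhoA ψ h]
  simp only [Matrix.trace, Matrix.diag_apply, rhoA_apply_eq_sum_rhoAC, rhoC_apply_eq_sum_rhoAC]
  exact Finset.sum_comm

theorem trace_mul_conjTranspose_self {m n : Type*} [Fintype m] [Fintype n] (X : Matrix m n ℂ) :
    (X * Xᴴ).trace = ((∑ p : m × n, Complex.normSq (X p.1 p.2) : ℝ) : ℂ) := by
  simp [Matrix.trace, Matrix.mul_apply, Complex.mul_conj, Fintype.sum_prod_type]

/-- A positive semidefinite matrix is `X * Xᴴ` for some `X` with independent columns. -/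
theorem Matrix.PosSemidef.exists_leftInverse_factor {m : Type*} [Fintype m] [DecidableEq m]
    {A : Matrix m m ℂ} (hA : A.PosSemidef) :
    ∃ (r : ℕ) (X : Matrix m (Fin r) ℂ) (Y : Matrix (Fin r) m ℂ), A = X * Xᴴ ∧ Y * X = 1 := by
  classical
  set ev := hA.isHermitian.eigenvalues
  set U : Matrix m m ℂ := hA.isHermitian.eigenvectorUnitary.1
  have hUU : Uᴴ * U = 1 := Unitary.coe_star_mul_self hA.isHermitian.eigenvectorUnitary
  have hspec : A = U * Matrix.diagonal (fun i => (ev i : ℂ)) * Uᴴ := by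
    have := hA.isHermitian.spectral_theorem
    rw [Unitary.conjStarAlgAut_apply] at this
    exact this
  have hnn : ∀ i, 0 ≤ ev i := hA.eigenvalues_nonneg
  let e : Fin (Fintype.card {i // ev i ≠ 0}) ≃ {i // ev i ≠ 0} := (Fintype.equivFin _).symm
  refine ⟨_, Matrix.of fun i s => U i (e s) * (√(ev (e s)) : ℝ),
    Matrix.of fun s i => ((√(ev (e s)) : ℝ) : ℂ)⁻¹ * Uᴴ (e s) i, ?_, ?_⟩
  · ext i i'
    conv_lhs =>
      rw [hspec, Matrix.mul_apply]
      simp only [Matrix.mul_diagonal]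
    simp only [Matrix.mul_apply, Matrix.conjTranspose_apply, Matrix.of_apply,
      star_mul', Complex.star_def, Complex.conj_ofReal]
    rw [e.sum_comp (fun s : {i // ev i ≠ 0} => U i s * ((√(ev s) : ℝ) : ℂ) *
      ((starRingEnd ℂ) (U i' s) * ((√(ev s) : ℝ) : ℂ)))]
    have key : ∀ s, U i s * ((√(ev s) : ℝ) : ℂ) *
        ((starRingEnd ℂ) (U i' s) * ((√(ev s) : ℝ) : ℂ)) =
        U i s * ev s * (starRingEnd ℂ) (U i' s) := by
      intro s
      have : (((√(ev s) : ℝ) : ℂ)) * ((√(ev s) : ℝ) : ℂ) = ev s := by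
        rw [← Complex.ofReal_mul, Real.mul_self_sqrt (hnn s)]
      rw [← this]
      ring
    simp only [key]
    rw [← Fintype.sum_subtype_add_sum_subtype (fun s => ev s ≠ 0), add_eq_left]
    exact Finset.sum_eq_zero fun s _ => by simp [not_not.mp s.2]
  · ext s t
    have hs : ((√(ev (e s)) : ℝ) : ℂ) ≠ 0 := by
      rw [Complex.ofReal_ne_zero, Real.sqrt_ne_zero (hnn _)]
      exact (e s).2
    have h1 := congrFun (congrFun hUU (e s)) (e t)
    rw [Matrix.mul_apply] at h1
    simp only [Matrix.mul_apply, Matrix.of_apply]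
    have : ∀ x, ((√(ev (e s)) : ℝ) : ℂ)⁻¹ * Uᴴ (e s) x * (U x (e t) * ((√(ev (e t)) : ℝ) : ℂ)) =
        ((√(ev (e s)) : ℝ) : ℂ)⁻¹ * ((√(ev (e t)) : ℝ) : ℂ) * (Uᴴ (e s) x * U x (e t)) := by
      intro x
      ring
    simp only [this]
    rw [← Finset.mul_sum, h1]
    by_cases hst : s = t
    · subst hst
      simp [hs]
    · have : (e s : m) ≠ e t := fun h => hst (e.injective (Subtype.ext h))
      simp [hst, this]

/-- Two factorizations of a positive semidefinite matrix, one of which has independent columns,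
differ by a coisometry. -/
theorem exists_coisometry_of_mul_conjTranspose_eq {m n p : Type*} [Fintype m] [Fintype n]
    [Fintype p] [DecidableEq m] [DecidableEq p] {M : Matrix m n ℂ} {X : Matrix m p ℂ}
    {Y : Matrix p m ℂ} (hM : M * Mᴴ = X * Xᴴ) (hY : Y * X = 1) :
    ∃ W : Matrix p n ℂ, W * Wᴴ = 1 ∧ M = X * W := by
  refine ⟨Y * M, ?_, ?_⟩
  · calc Y * M * (Y * M)ᴴ = Y * (M * Mᴴ) * Yᴴ := by
          simp only [Matrix.conjTranspose_mul, Matrix.mul_assoc]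
      _ = (Y * X) * (Y * X)ᴴ := by
          rw [hM]
          simp only [Matrix.conjTranspose_mul, Matrix.mul_assoc]
      _ = 1 := by simp [hY]
  · have h0 : (1 - X * Y) * X = 0 := by
      rw [Matrix.sub_mul, Matrix.mul_assoc, hY]
      simp
    have h1 : ((1 - X * Y) * M) * ((1 - X * Y) * M)ᴴ = 0 := by
      calc _ = (1 - X * Y) * (M * Mᴴ) * (1 - X * Y)ᴴ := by
            simp only [Matrix.conjTranspose_mul, Matrix.mul_assoc]
        _ = 0 := by rw [hM, ← Matrix.mul_assoc, h0]; simp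
    rw [Matrix.self_mul_conjTranspose_eq_zero, Matrix.sub_mul, sub_eq_zero] at h1
    simpa [Matrix.mul_assoc] using h1

/-- `ρ_AC = ρ_A ⊗ ρ_C` iff `ψ` is (via an isometry on the middle system) a product of a
state on `A ⊗ B_L` and a state on `B_R ⊗ C`. -/
theorem stmt17 {dA dB dC : ℕ} (ψ : Fin dA × Fin dB × Fin dC → ℂ)
    (hnorm : Normalized ψ) :
    rhoAC ψ = rhoA ψ ⊗ₖ rhoC ψ ↔
      ∃ (dBL dBR : ℕ) (V : Matrix (Fin dB) (Fin dBL × Fin dBR) ℂ)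
        (ψ₁ : Fin dA × Fin dBL → ℂ) (ψ₂ : Fin dBR × Fin dC → ℂ),
        Vᴴ * V = 1 ∧
        (∑ p : Fin dA × Fin dBL, Complex.normSq (ψ₁ p)) = 1 ∧
        (∑ p : Fin dBR × Fin dC, Complex.normSq (ψ₂ p)) = 1 ∧
        ∀ (i : Fin dA) (j : Fin dB) (k : Fin dC),
          ψ (i, j, k) = ∑ l : Fin dBL, ∑ r : Fin dBR, ψ₁ (i, l) * ψ₂ (r, k) * V j (l, r) := by
  constructor
  · intro h
    obtain ⟨dBL, X₁, Y₁, hX₁, hY₁⟩ := (posSemidef_rhoA ψ).exists_leftInverse_factor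
    obtain ⟨dBR, X₂, Y₂, hX₂, hY₂⟩ := (posSemidef_rhoC ψ).exists_leftInverse_factor
    have hM : amplitudeMatrix ψ * (amplitudeMatrix ψ)ᴴ = (X₁ ⊗ₖ X₂) * (X₁ ⊗ₖ X₂)ᴴ := by
      rw [← rhoAC_eq_mul_conjTranspose, h, Matrix.conjTranspose_kronecker,
        ← Matrix.mul_kronecker_mul, ← hX₁, ← hX₂]
    have hY : (Y₁ ⊗ₖ Y₂) * (X₁ ⊗ₖ X₂) = 1 := by
      rw [← Matrix.mul_kronecker_mul, hY₁, hY₂, Matrix.one_kronecker_one]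
    obtain ⟨W, hW, hMW⟩ := exists_coisometry_of_mul_conjTranspose_eq hM hY
    refine ⟨dBL, dBR, Wᵀ, fun p => X₁ p.1 p.2, fun p => X₂ p.2 p.1, ?_, ?_, ?_, ?_⟩
    · have := congrArg Matrix.transpose hW
      rwa [Matrix.transpose_mul, Matrix.transpose_one] at this
    · have := trace_mul_conjTranspose_self X₁
      rw [← hX₁, trace_rhoA ψ hnorm] at this
      exact_mod_cast this.symm
    · have := trace_mul_conjTranspose_self X₂
      rw [← hX₂, trace_rhoC ψ hnorm] at this
      rw [← (Equiv.prodComm _ _).sum_comp]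
      exact_mod_cast this.symm
    · intro i j k
      have := congrFun (congrFun hMW (i, k)) j
      simpa [amplitudeMatrix, Matrix.mul_apply, Fintype.sum_prod_type] using this
  · rintro ⟨dBL, dBR, V, ψ₁, ψ₂, hV, h₁, h₂, hψ⟩
    let X₁ : Matrix (Fin dA) (Fin dBL) ℂ := Matrix.of fun i l => ψ₁ (i, l)
    let X₂ : Matrix (Fin dC) (Fin dBR) ℂ := Matrix.of fun k r => ψ₂ (r, k)
    have hM : amplitudeMatrix ψ = (X₁ ⊗ₖ X₂) * Vᵀ := by
      ext p j
      simp [amplitudeMatrix, Matrix.mul_apply, Fintype.sum_prod_type, X₁, X₂, hψ]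
    have hVT : Vᵀ * Vᵀᴴ = 1 := by
      have := congrArg Matrix.transpose hV
      rwa [Matrix.transpose_mul, Matrix.transpose_one] at this
    have hAC : rhoAC ψ = (X₁ * X₁ᴴ) ⊗ₖ (X₂ * X₂ᴴ) := by
      rw [rhoAC_eq_mul_conjTranspose, hM, Matrix.conjTranspose_mul, Matrix.mul_assoc,
        ← Matrix.mul_assoc Vᵀ, hVT, Matrix.one_mul, Matrix.conjTranspose_kronecker,
        ← Matrix.mul_kronecker_mul]
    have ht₁ : (X₁ * X₁ᴴ).trace = 1 := by
      rw [trace_mul_conjTranspose_self]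
      exact_mod_cast h₁
    have ht₂ : (X₂ * X₂ᴴ).trace = 1 := by
      rw [trace_mul_conjTranspose_self, ← (Equiv.prodComm _ _).sum_comp]
      exact_mod_cast h₂
    have hA : rhoA ψ = X₁ * X₁ᴴ := by
      ext i i'
      simp only [rhoA_apply_eq_sum_rhoAC, hAC, Matrix.kroneckerMap_apply]
      rw [← Finset.mul_sum]
      exact (congrArg _ ht₂).trans (mul_one _)
    have hC : rhoC ψ = X₂ * X₂ᴴ := by
      ext k k'
      simp only [rhoC_apply_eq_sum_rhoAC, hAC, Matrix.kroneckerMap_apply]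
      rw [← Finset.sum_mul]
      exact (congrArg (· * _) ht₁).trans (one_mul _)
    rw [hAC, hA, hC]
end
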